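/- arXiv:1207.1267 — 2 statements merged into one kernel-verified Lean document; each statement's English description precedes it below -/
import Mathlib

section
/- Let α : ℝ → ℝ be a function of bounded variation on ℝ with compact support, let φ solve dφ_t(x) = α(φ_t(x))dt + dw(t), φ_0(x) = x, and let φⁿ solve the same equation with α replaced by the mollification αₙ. Then for all t ≥ 0 and all x, y ∈ ℝ, E|L_y^{φⁿ(x)}(t) − L_y^{φ(x)}(t)|² → 0 as n → ∞, where L_y^{φ(x)}(t) and L_y^{φⁿ(x)}(t) are the local times of the respective processes at the point y. -/
open MeasureTheory ProbabilityTheory Filter Set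

noncomputable section

/-- The σ-algebra generated by the process `w` up to time `t` (natural filtration). -/
def natSigma {Ω : Type*} [MeasurableSpace Ω] (w : ℝ → Ω → ℝ) (t : ℝ) : MeasurableSpace Ω :=
  ⨆ s ∈ Set.Icc (0:ℝ) t, MeasurableSpace.comap (w s) inferInstance

/-- `w` is a one-dimensional Wiener process (Brownian motion) on `[0,∞)`:
continuous paths started at `0`, Gaussian increments `w t - w s ~ N(0, t-s)`,
and increments independent of the past. -/
structure IsWiener {Ω : Type*} [MeasureSpace Ω] (w : ℝ → Ω → ℝ) : Prop where
  isProb : IsProbabilityMeasure (ℙ : Measure Ω)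
  meas : ∀ t : ℝ, Measurable (w t)
  init : ∀ᵐ ω ∂(ℙ : Measure Ω), w 0 ω = 0
  cont : ∀ᵐ ω ∂(ℙ : Measure Ω), Continuous fun t => w t ω
  gauss : ∀ s t : ℝ, 0 ≤ s → s ≤ t →
    Measure.map (fun ω => w t ω - w s ω) ℙ = gaussianReal 0 ((t - s).toNNReal)
  indep : ∀ s t : ℝ, 0 ≤ s → s ≤ t →
    Indep (MeasurableSpace.comap (fun ω => w t ω - w s ω) inferInstance) (natSigma w s) ℙ

/-- `φ` is a strong solution of the SDE `dφ_t = α(φ_t) dt + dw(t)`, `φ_0 = x`: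
it is adapted to the natural filtration of `w`, has continuous paths, and satisfies
the corresponding integral equation `φ_t = x + ∫_0^t α(φ_s) ds + w_t`. -/
structure IsStrongSolution {Ω : Type*} [MeasureSpace Ω] (α : ℝ → ℝ) (w : ℝ → Ω → ℝ)
    (x : ℝ) (φ : ℝ → Ω → ℝ) : Prop where
  adapted : ∀ t : ℝ, 0 ≤ t → @Measurable Ω ℝ (natSigma w t) _ (φ t)
  init : ∀ ω, φ 0 ω = x
  cont : ∀ᵐ ω ∂(ℙ : Measure Ω), ContinuousOn (fun t => φ t ω) (Set.Ici 0)
  sde : ∀ᵐ ω ∂(ℙ : Measure Ω), ∀ t : ℝ, 0 ≤ t →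
    φ t ω = x + (∫ s in (0:ℝ)..t, α (φ s ω)) + w t ω

/-- `L` is the local time of the path `X` at level `y` up to time `t`:
`L = lim_{ε↓0} (1/ε) ∫_0^t 1_{[y,y+ε)}(X_s) ds`. -/
def IsLocalTime (X : ℝ → ℝ) (y t L : ℝ) : Prop :=
  Filter.Tendsto
    (fun ε : ℝ => (1/ε) * ∫ s in (0:ℝ)..t,
      Set.indicator (Set.Ico y (y + ε)) (fun _ => (1:ℝ)) (X s))
    (nhdsWithin 0 (Set.Ioi 0)) (nhds L)

/-- Condition (A): `α` has bounded variation on each compact subset of `ℝ`. -/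
def CondA (α : ℝ → ℝ) : Prop := ∀ a b : ℝ, BoundedVariationOn α (Set.Icc a b)

/-- Condition (B): linear growth, `|α x|² ≤ C (1 + |x|²)` for some `C > 0`. -/
def CondB (α : ℝ → ℝ) : Prop := ∃ C > 0, ∀ x : ℝ, |α x| ^ 2 ≤ C * (1 + |x| ^ 2)

/-- Condition (C): `α` has bounded variation on all of `ℝ`. -/
def CondC (α : ℝ → ℝ) : Prop := BoundedVariationOn α Set.univ

/-- `g` is a sequence of mollifiers: `g n` is a `C¹` nonnegative function vanishing
outside `(-1/n, 1/n)` with total integral `1`. -/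
def IsMollifier (g : ℕ → ℝ → ℝ) : Prop :=
  ∀ n : ℕ, 1 ≤ n → ContDiff ℝ 1 (g n) ∧ (∀ x, 0 ≤ g n x) ∧
    (∀ x : ℝ, x ∉ Set.Ioo (-(1/(n:ℝ))) (1/(n:ℝ)) → g n x = 0) ∧ (∫ z, g n z) = 1

/-- The mollification `αₙ(x) = ∫_ℝ gₙ(x-y) α(y) dy`. -/
def mollify (g : ℕ → ℝ → ℝ) (α : ℝ → ℝ) (n : ℕ) (x : ℝ) : ℝ := ∫ y, g n (x - y) * α y

theorem abs_taylor_remainder_le {f p h : ℝ → ℝ} {K : ℝ} (hf : ∀ z, HasDerivAt f (p z) z)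
    (hp : ∀ z, HasDerivAt p (h z) z) (hK : ∀ a b, |h a - h b| ≤ K * |a - b|) (a b : ℝ) :
    |f b - f a - p a * (b - a) - h a / 2 * (b - a) ^ 2| ≤ K * |b - a| ^ 3 := by
  have hK0 : 0 ≤ K := by
    have := (abs_nonneg _).trans (hK 1 0)
    simpa using this
  have hdist : ∀ z ∈ uIcc a b, |z - a| ≤ |b - a| := fun z hz => abs_sub_left_of_mem_uIcc hz
  have hfirst : ∀ z ∈ uIcc a b, |p z - p a - h a * (z - a)| ≤ K * |b - a| * |b - a| := by
    intro z hz
    have hder : ∀ u ∈ uIcc a b, HasDerivWithinAt (fun u => p u - h a * (u - a)) (h u - h a)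
        (uIcc a b) u := by
      intro u _
      have := ((hp u).sub (((hasDerivAt_id u).sub_const a).const_mul (h a))).hasDerivWithinAt
        (s := uIcc a b)
      exact this.congr_deriv (by simp)
    have := (convex_uIcc a b).norm_image_sub_le_of_norm_hasDerivWithin_le (C := K * |b - a|) hder
      (fun u hu => (hK u a).trans (mul_le_mul_of_nonneg_left (hdist u hu) hK0))
      left_mem_uIcc hz
    simp only [Real.norm_eq_abs, sub_self, mul_zero, sub_zero] at this
    calc |p z - p a - h a * (z - a)| = |p z - h a * (z - a) - p a| := by ring_nf
      _ ≤ K * |b - a| * |z - a| := this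
      _ ≤ _ := mul_le_mul_of_nonneg_left (hdist z hz) (by positivity)
  have hder : ∀ u ∈ uIcc a b, HasDerivWithinAt
      (fun u => f u - p a * (u - a) - h a / 2 * (u - a) ^ 2) (p u - p a - h a * (u - a))
      (uIcc a b) u := by
    intro u _
    have h1 := (hasDerivAt_id u).sub_const a
    have := (((hf u).sub (h1.const_mul (p a))).sub ((h1.pow 2).const_mul (h a / 2))).hasDerivWithinAt
        (s := uIcc a b)
    refine this.congr_deriv ?_
    simp
    ring
  have := (convex_uIcc a b).norm_image_sub_le_of_norm_hasDerivWithin_le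
    (C := K * |b - a| * |b - a|) hder hfirst left_mem_uIcc right_mem_uIcc
  simp only [Real.norm_eq_abs, sub_self, mul_zero, sub_zero] at this
  calc _ = |f b - p a * (b - a) - h a / 2 * (b - a) ^ 2 - (f a - h a / 2 * 0 ^ 2)| := by ring_nf
    _ ≤ _ := this
    _ = _ := by ring

theorem tendsto_riemann_sum {u : ℝ → ℝ} {t : ℝ} (ht : 0 ≤ t) (hu : ContinuousOn u (Icc 0 t)) :
    Tendsto (fun m : ℕ => ∑ i ∈ Finset.range (m + 1), u (i * (t / (m + 1))) * (t / (m + 1))) atTop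
      (nhds (∫ s in (0 : ℝ)..t, u s)) := by
  have huc := isCompact_Icc.uniformContinuousOn_of_continuous hu
  rw [Metric.tendsto_atTop]
  intro ε hε
  obtain ⟨δ, hδ, hδu⟩ := Metric.uniformContinuousOn_iff.1 huc (ε / (t + 1)) (by positivity)
  obtain ⟨N, hN⟩ := exists_nat_gt (t / δ)
  refine ⟨N, fun m hm => ?_⟩
  set D : ℝ := t / (m + 1) with hD
  have hm1 : (0 : ℝ) < m + 1 := by positivity
  have hD0 : 0 ≤ D := by positivity
  have hDδ : D < δ := by
    rw [hD, div_lt_iff₀ hm1]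
    rw [div_lt_iff₀ hδ] at hN
    have : (N : ℝ) ≤ m := by exact_mod_cast hm
    nlinarith
  have hmD : ((m : ℝ) + 1) * D = t := by rw [hD]; field_simp
  have hmem : ∀ i ≤ m + 1, (i : ℝ) * D ∈ Icc 0 t := by
    intro i hi
    have : (i : ℝ) ≤ m + 1 := by exact_mod_cast hi
    exact ⟨by positivity, by nlinarith⟩
  have hsub : ∀ i < m + 1, Icc ((i : ℝ) * D) ((i + 1 : ℕ) * D) ⊆ Icc 0 t := fun i hi =>
    Icc_subset_Icc (hmem i hi.le).1 (hmem (i + 1) hi).2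
  have hle : ∀ i : ℕ, (i : ℝ) * D ≤ ((i + 1 : ℕ) : ℝ) * D := fun i => by
    push_cast; nlinarith
  have hint : ∀ i < m + 1, IntervalIntegrable u volume ((i : ℝ) * D) ((i + 1 : ℕ) * D) :=
    fun i hi => (hu.mono (by rw [uIcc_of_le (hle i)]; exact hsub i hi)).intervalIntegrable
  have hsum := intervalIntegral.sum_integral_adjacent_intervals (a := fun i : ℕ => (i : ℝ) * D)
    (f := u) (μ := volume) (n := m + 1) hint
  simp only [Nat.cast_zero, zero_mul, Nat.cast_add, Nat.cast_one, hmD] at hsum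
  rw [← hsum, Real.dist_eq, ← Finset.sum_sub_distrib]
  have hterm : ∀ i ∈ Finset.range (m + 1),
      |u (i * D) * D - ∫ s in (i : ℝ) * D..((i : ℝ) + 1) * D, u s| ≤ ε / (t + 1) * D := by
    intro i hi
    have hi := Finset.mem_range.1 hi
    have h1 : u (i * D) * D = ∫ s in (i : ℝ) * D..((i : ℝ) + 1) * D, u (i * D) := by
      rw [intervalIntegral.integral_const, smul_eq_mul]; ring
    have hint' := hint i hi
    push_cast at hint'
    rw [h1, ← intervalIntegral.integral_sub intervalIntegrable_const hint']
    have := intervalIntegral.norm_integral_le_of_norm_le_const (a := (i : ℝ) * D)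
      (b := ((i : ℝ) + 1) * D) (f := fun s => u (i * D) - u s) (C := ε / (t + 1)) ?_
    · refine this.trans (le_of_eq ?_)
      rw [show ((i : ℝ) + 1) * D - i * D = D by ring, abs_of_nonneg hD0]
    · intro s hs
      have hle' := hle i
      push_cast at hle'
      rw [uIoc_of_le hle'] at hs
      rw [← dist_eq_norm]
      refine (hδu _ (hmem i hi.le) s (hsub i hi ⟨hs.1.le, by push_cast; exact hs.2⟩) ?_).le
      rw [dist_comm, Real.dist_eq, abs_of_pos (by linarith [hs.1])]
      nlinarith [hs.2]
  calc _ ≤ ∑ i ∈ Finset.range (m + 1), ε / (t + 1) * D :=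
        (Finset.abs_sum_le_sum_abs _ _).trans (Finset.sum_le_sum hterm)
    _ = ε * (t / (t + 1)) := by
        rw [Finset.sum_const, Finset.card_range, nsmul_eq_mul]
        push_cast
        rw [← hmD]; ring
    _ < ε * 1 := by
        refine mul_lt_mul_of_pos_left ?_ hε
        rw [div_lt_one (by positivity)]; linarith
    _ = ε := mul_one ε

theorem abs_sub_le_of_hasDerivAt {f p : ℝ → ℝ} {b : ℝ} (hf : ∀ z, HasDerivAt f (p z) z)
    (hb : ∀ z, |p z| ≤ b) (u v : ℝ) : |f v - f u| ≤ b * |v - u| :=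
  convex_univ.norm_image_sub_le_of_norm_hasDerivWithin_le
    (fun z _ => (hf z).hasDerivWithinAt) (fun z _ => hb z) (mem_univ u) (mem_univ v)

section Wiener

variable {Ω : Type*} [MeasureSpace Ω] {w : ℝ → Ω → ℝ}

theorem natSigma_mono {s t : ℝ} (hst : s ≤ t) : natSigma w s ≤ natSigma w t :=
  biSup_mono fun _ hr => ⟨hr.1, hr.2.trans hst⟩

theorem measurable_natSigma {s t : ℝ} (hs : 0 ≤ s) (hst : s ≤ t) :
    Measurable[natSigma w t] (w s) := by
  rw [measurable_iff_comap_le]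
  exact le_biSup (fun s => MeasurableSpace.comap (w s) inferInstance) (⟨hs, hst⟩ : s ∈ Icc 0 t)

namespace IsWiener

theorem natSigma_le (hw : IsWiener w) (t : ℝ) :
    natSigma w t ≤ (inferInstance : MeasurableSpace Ω) :=
  iSup₂_le fun s _ => (hw.meas s).comap_le

theorem measurable_sub (hw : IsWiener w) (s t : ℝ) : Measurable fun ω => w t ω - w s ω :=
  (hw.meas t).sub (hw.meas s)

theorem map_sub (hw : IsWiener w) {s t : ℝ} (hs : 0 ≤ s) (hst : s ≤ t) :
    Measure.map (fun ω => w t ω - w s ω) ℙ =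
      (gaussianReal 0 1).map (fun z => √(t - s) * z) := by
  rw [hw.gauss s t hs hst, gaussianReal_map_const_mul]
  congr 1
  · simp
  · ext
    simp [Real.sq_sqrt (sub_nonneg.2 hst), Real.coe_toNNReal _ (sub_nonneg.2 hst)]

theorem integral_comp_sub (hw : IsWiener w) {s t : ℝ} (hs : 0 ≤ s) (hst : s ≤ t) {G : ℝ → ℝ}
    (hG : Measurable G) :
    ∫ ω, G (w t ω - w s ω) ∂ℙ = ∫ z, G (√(t - s) * z) ∂(gaussianReal 0 1) := by
  rw [← integral_map (f := G) (hw.measurable_sub s t).aemeasurable hG.aestronglyMeasurable,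
    hw.map_sub hs hst, integral_map (by fun_prop) hG.aestronglyMeasurable]

theorem integrable_comp_sub_iff (hw : IsWiener w) {s t : ℝ} (hs : 0 ≤ s) (hst : s ≤ t) {G : ℝ → ℝ}
    (hG : Measurable G) :
    Integrable (fun ω => G (w t ω - w s ω)) ℙ ↔
      Integrable (fun z => G (√(t - s) * z)) (gaussianReal 0 1) := by
  have h1 := integrable_map_measure (μ := (ℙ : Measure Ω)) (g := G)
    hG.aestronglyMeasurable (hw.measurable_sub s t).aemeasurable
  have h2 := integrable_map_measure (μ := gaussianReal 0 1) (g := G) (f := fun z => √(t - s) * z)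
    hG.aestronglyMeasurable (by fun_prop)
  rw [hw.map_sub hs hst] at h1
  exact h1.symm.trans h2

end IsWiener

theorem integrable_abs_pow_gaussianReal (k : ℕ) :
    Integrable (fun z : ℝ => |z| ^ k) (gaussianReal 0 1) := by
  have := (memLp_id_gaussianReal' (μ := 0) (v := 1) (k : ENNReal) (by simp)).integrable_norm_pow'
  simpa using this

theorem integrable_pow_gaussianReal (k : ℕ) :
    Integrable (fun z : ℝ => z ^ k) (gaussianReal 0 1) :=
  (integrable_abs_pow_gaussianReal k).mono' (by fun_prop)
    (ae_of_all _ fun z => by simp)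

theorem integral_sq_gaussianReal : ∫ z : ℝ, z ^ 2 ∂(gaussianReal 0 1) = 1 := by
  have := variance_fun_id_gaussianReal (μ := 0) (v := 1)
  rw [variance_eq_integral (by fun_prop)] at this
  simpa using this

namespace IsWiener

theorem integrable_sub_pow (hw : IsWiener w) {s t : ℝ} (hs : 0 ≤ s) (hst : s ≤ t) (k : ℕ) :
    Integrable (fun ω => (w t ω - w s ω) ^ k) ℙ := by
  rw [hw.integrable_comp_sub_iff (G := fun z => z ^ k) hs hst (by fun_prop)]
  simp only [mul_pow]
  exact (integrable_pow_gaussianReal k).const_mul _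

theorem integral_sub (hw : IsWiener w) {s t : ℝ} (hs : 0 ≤ s) (hst : s ≤ t) :
    ∫ ω, (w t ω - w s ω) ∂ℙ = 0 := by
  rw [hw.integral_comp_sub (G := fun z => z) hs hst (by fun_prop), integral_const_mul,
    integral_id_gaussianReal, mul_zero]

theorem integral_sub_sq (hw : IsWiener w) {s t : ℝ} (hs : 0 ≤ s) (hst : s ≤ t) :
    ∫ ω, (w t ω - w s ω) ^ 2 ∂ℙ = t - s := by
  rw [hw.integral_comp_sub (G := fun z => z ^ 2) hs hst (by fun_prop)]
  simp only [mul_pow]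
  rw [integral_const_mul, integral_sq_gaussianReal, Real.sq_sqrt (sub_nonneg.2 hst), mul_one]

theorem indepFun_sub (hw : IsWiener w) {s t : ℝ} (hs : 0 ≤ s) (hst : s ≤ t) {Y : Ω → ℝ}
    (hY : Measurable[natSigma w s] Y) {G : ℝ → ℝ} (hG : Measurable G) :
    IndepFun Y (fun ω => G (w t ω - w s ω)) ℙ := by
  have h : IndepFun Y (fun ω => w t ω - w s ω) ℙ := by
    rw [IndepFun_iff_Indep]
    exact (indep_of_indep_of_le_right (hw.indep s t hs hst) hY.comap_le).symm
  exact h.comp measurable_id hG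

theorem integral_mul_comp_sub (hw : IsWiener w) {s t : ℝ} (hs : 0 ≤ s) (hst : s ≤ t) {Y : Ω → ℝ}
    (hY : Measurable[natSigma w s] Y) {G : ℝ → ℝ} (hG : Measurable G) :
    ∫ ω, Y ω * G (w t ω - w s ω) ∂ℙ = (∫ ω, Y ω ∂ℙ) * ∫ ω, G (w t ω - w s ω) ∂ℙ :=
  (hw.indepFun_sub hs hst hY hG).integral_fun_mul_eq_mul_integral
    (hY.mono (hw.natSigma_le s) le_rfl).aestronglyMeasurable
    (hG.comp (hw.measurable_sub s t)).aestronglyMeasurable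

theorem integrable_mul_comp_sub (hw : IsWiener w) {s t : ℝ} (hs : 0 ≤ s) (hst : s ≤ t) {Y : Ω → ℝ}
    (hY : Measurable[natSigma w s] Y) (hYi : Integrable Y ℙ) {G : ℝ → ℝ} (hG : Measurable G)
    (hGi : Integrable (fun ω => G (w t ω - w s ω)) ℙ) :
    Integrable (fun ω => Y ω * G (w t ω - w s ω)) ℙ :=
  (hw.indepFun_sub hs hst hY hG).integrable_mul hYi hGi

end IsWiener

end Wiener

section Drifted

variable {Ω : Type*} [MeasureSpace Ω] {w : ℝ → Ω → ℝ}

/-- `X` is the sum of `x`, of `w`, and of an adapted process whose paths start at `0` and are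
`C`-Lipschitz. -/
structure IsDrifted (w : ℝ → Ω → ℝ) (C x : ℝ) (X : ℝ → Ω → ℝ) : Prop where
  adapted : ∀ t : ℝ, 0 ≤ t → Measurable[natSigma w t] (X t)
  init : ∀ᵐ ω ∂(ℙ : Measure Ω), X 0 ω = x
  lip : ∀ᵐ ω ∂(ℙ : Measure Ω), ∀ s t : ℝ, 0 ≤ s → s ≤ t →
    |(X t ω - w t ω) - (X s ω - w s ω)| ≤ C * (t - s)

theorem memLp_two_and_integral_sq_sum_le (hw : IsWiener w) {D b M : ℝ} (hD : 0 ≤ D)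
    {A H : ℕ → Ω → ℝ} (hA : ∀ i : ℕ, Measurable[natSigma w (i * D)] (A i))
    (hH : ∀ i : ℕ, Measurable[natSigma w (i * D)] (H i)) (hAb : ∀ i ω, |A i ω| ≤ b)
    (hHM : ∀ i ω, |H i ω| ≤ M) (n : ℕ) :
    Measurable[natSigma w (n * D)] (fun ω => ∑ i ∈ Finset.range n,
      (A i ω * (w ((i + 1 : ℕ) * D) ω - w (i * D) ω) +
        H i ω * ((w ((i + 1 : ℕ) * D) ω - w (i * D) ω) ^ 2 - D))) ∧
    Integrable (fun ω => (∑ i ∈ Finset.range n,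
      (A i ω * (w ((i + 1 : ℕ) * D) ω - w (i * D) ω) +
        H i ω * ((w ((i + 1 : ℕ) * D) ω - w (i * D) ω) ^ 2 - D))) ^ 2) ℙ ∧
    ∫ ω, (∑ i ∈ Finset.range n,
      (A i ω * (w ((i + 1 : ℕ) * D) ω - w (i * D) ω) +
        H i ω * ((w ((i + 1 : ℕ) * D) ω - w (i * D) ω) ^ 2 - D))) ^ 2 ∂ℙ ≤
      ∑ i ∈ Finset.range n, (2 * D * (∫ ω, A i ω ^ 2 ∂ℙ) +
        2 * M ^ 2 * (D ^ 2 * ∫ z, (z ^ 2 - 1) ^ 2 ∂(gaussianReal 0 1))) := by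
  have := hw.isProb
  induction n with
  | zero => simp
  | succ n ih =>
    obtain ⟨hSm, hSi, hSle⟩ := ih
    set S : Ω → ℝ := fun ω => ∑ i ∈ Finset.range n,
      (A i ω * (w ((i + 1 : ℕ) * D) ω - w (i * D) ω) +
        H i ω * ((w ((i + 1 : ℕ) * D) ω - w (i * D) ω) ^ 2 - D)) with hS
    have h0 : (0 : ℝ) ≤ n * D := by positivity
    have h1 : (n : ℝ) * D ≤ (n + 1 : ℕ) * D := by push_cast; nlinarith
    have hdiff : ((n + 1 : ℕ) : ℝ) * D - n * D = D := by push_cast; ring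
    set Δ : Ω → ℝ := fun ω => w ((n + 1 : ℕ) * D) ω - w (n * D) ω with hΔ
    have hΔm' : Measurable[natSigma w ((n + 1 : ℕ) * D)] Δ :=
      (measurable_natSigma (h0.trans h1) le_rfl).sub (measurable_natSigma h0 h1)
    have hΔm : Measurable Δ := hw.measurable_sub _ _
    have hpow : ∀ k : ℕ, Integrable (fun ω => Δ ω ^ k) ℙ := fun k => hw.integrable_sub_pow h0 h1 k
    have hmeas : ∀ {Y : Ω → ℝ}, Measurable[natSigma w (n * D)] Y → Measurable Y :=
      fun hY => hY.mono (hw.natSigma_le _) le_rfl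
    have hΔ2i : Integrable (fun ω => Δ ω ^ 2 - D) ℙ := (hpow 2).sub (integrable_const _)
    have hΔ4i : Integrable (fun ω => (Δ ω ^ 2 - D) ^ 2) ℙ := by
      have : (fun ω => (Δ ω ^ 2 - D) ^ 2) = fun ω => Δ ω ^ 4 - 2 * D * Δ ω ^ 2 + D ^ 2 := by
        ext; ring
      rw [this]
      exact ((hpow 4).sub ((hpow 2).const_mul _)).add (integrable_const _)
    have hE1 : ∫ ω, Δ ω ∂ℙ = 0 := hw.integral_sub h0 h1
    have hE2 : ∫ ω, Δ ω ^ 2 ∂ℙ = D := by rw [hw.integral_sub_sq h0 h1, hdiff]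
    have hE2' : ∫ ω, (Δ ω ^ 2 - D) ∂ℙ = 0 := by
      rw [integral_sub (hpow 2) (integrable_const _), hE2]; simp
    have hE4 : ∫ ω, (Δ ω ^ 2 - D) ^ 2 ∂ℙ = D ^ 2 * ∫ z, (z ^ 2 - 1) ^ 2 ∂(gaussianReal 0 1) := by
      rw [hw.integral_comp_sub (G := fun z => (z ^ 2 - D) ^ 2) h0 h1 (by fun_prop), hdiff,
        ← integral_const_mul]
      refine integral_congr_ae (ae_of_all _ fun z => ?_)
      simp only [mul_pow, Real.sq_sqrt hD]
      ring
    have hSL : Integrable S ℙ :=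
      ((memLp_two_iff_integrable_sq (hmeas hSm).aestronglyMeasurable).2 hSi).integrable
        (by norm_num)
    have hSA : Integrable (fun ω => S ω * A n ω) ℙ :=
      hSL.mul_bdd (hmeas (hA n)).aestronglyMeasurable (ae_of_all _ (hAb n))
    have hSH : Integrable (fun ω => S ω * H n ω) ℙ :=
      hSL.mul_bdd (hmeas (hH n)).aestronglyMeasurable (ae_of_all _ (hHM n))
    have hcross1i : Integrable (fun ω => S ω * A n ω * Δ ω) ℙ :=
      hw.integrable_mul_comp_sub (G := fun z => z) h0 h1 (hSm.mul (hA n)) hSA measurable_id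
        (by simpa only [pow_one] using hpow 1)
    have hcross2i : Integrable (fun ω => S ω * H n ω * (Δ ω ^ 2 - D)) ℙ :=
      hw.integrable_mul_comp_sub (G := fun z => z ^ 2 - D) h0 h1 (hSm.mul (hH n)) hSH
        (by fun_prop) hΔ2i
    have hcross1 : ∫ ω, S ω * A n ω * Δ ω ∂ℙ = 0 := by
      refine (hw.integral_mul_comp_sub (G := fun z => z) h0 h1 (hSm.mul (hA n))
        measurable_id).trans ?_
      rw [hE1, mul_zero]
    have hcross2 : ∫ ω, S ω * H n ω * (Δ ω ^ 2 - D) ∂ℙ = 0 := by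
      refine (hw.integral_mul_comp_sub (G := fun z => z ^ 2 - D) h0 h1 (hSm.mul (hH n))
        (by fun_prop)).trans ?_
      rw [hE2', mul_zero]
    have hA2 : Integrable (fun ω => A n ω ^ 2) ℙ :=
      Integrable.of_bound ((hmeas (hA n)).pow_const 2).aestronglyMeasurable (b ^ 2)
        (ae_of_all _ fun ω => by
          rw [Real.norm_eq_abs, abs_pow]
          exact pow_le_pow_left₀ (abs_nonneg _) (hAb n ω) 2)
    have hAΔi : Integrable (fun ω => A n ω ^ 2 * Δ ω ^ 2) ℙ :=
      hw.integrable_mul_comp_sub (G := fun z => z ^ 2) h0 h1 ((hA n).pow_const 2) hA2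
        (by fun_prop) (hpow 2)
    have hAΔ : ∫ ω, A n ω ^ 2 * Δ ω ^ 2 ∂ℙ = (∫ ω, A n ω ^ 2 ∂ℙ) * D := by
      rw [hw.integral_mul_comp_sub (G := fun z => z ^ 2) h0 h1 ((hA n).pow_const 2) (by fun_prop),
        hE2]
    have hNle : ∀ ω, (A n ω * Δ ω + H n ω * (Δ ω ^ 2 - D)) ^ 2 ≤
        2 * (A n ω ^ 2 * Δ ω ^ 2) + 2 * M ^ 2 * (Δ ω ^ 2 - D) ^ 2 := fun ω => by
      have hH2 : H n ω ^ 2 ≤ M ^ 2 := by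
        rw [← sq_abs]; exact pow_le_pow_left₀ (abs_nonneg _) (hHM n ω) 2
      nlinarith [sq_nonneg (A n ω * Δ ω - H n ω * (Δ ω ^ 2 - D)),
        mul_le_mul_of_nonneg_right hH2 (sq_nonneg (Δ ω ^ 2 - D))]
    have hNdi : Integrable (fun ω => 2 * (A n ω ^ 2 * Δ ω ^ 2) +
        2 * M ^ 2 * (Δ ω ^ 2 - D) ^ 2) ℙ := (hAΔi.const_mul _).add (hΔ4i.const_mul _)
    have hNm' : Measurable fun ω => A n ω * Δ ω + H n ω * (Δ ω ^ 2 - D) := by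
      have := hmeas (hA n); have := hmeas (hH n); fun_prop
    have hNi : Integrable (fun ω => (A n ω * Δ ω + H n ω * (Δ ω ^ 2 - D)) ^ 2) ℙ :=
      hNdi.mono' (hNm'.pow_const 2).aestronglyMeasurable
        (ae_of_all _ fun ω => by rw [Real.norm_eq_abs, abs_of_nonneg (sq_nonneg _)]; exact hNle ω)
    have hNint : ∫ ω, (A n ω * Δ ω + H n ω * (Δ ω ^ 2 - D)) ^ 2 ∂ℙ ≤
        2 * D * (∫ ω, A n ω ^ 2 ∂ℙ) +
          2 * M ^ 2 * (D ^ 2 * ∫ z, (z ^ 2 - 1) ^ 2 ∂(gaussianReal 0 1)) := by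
      refine (integral_mono hNi hNdi hNle).trans (le_of_eq ?_)
      rw [integral_add (hAΔi.const_mul _) (hΔ4i.const_mul _), integral_const_mul,
        integral_const_mul, hAΔ, hE4]
      ring
    have hexp : ∀ ω, (S ω + (A n ω * Δ ω + H n ω * (Δ ω ^ 2 - D))) ^ 2 =
        S ω ^ 2 + 2 * (S ω * A n ω * Δ ω) + 2 * (S ω * H n ω * (Δ ω ^ 2 - D)) +
          (A n ω * Δ ω + H n ω * (Δ ω ^ 2 - D)) ^ 2 := fun ω => by ring
    simp only [Finset.sum_range_succ]
    refine ⟨?_, ?_, ?_⟩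
    · have hle := natSigma_mono (w := w) h1
      exact (hSm.mono hle le_rfl).add ((((hA n).mono hle le_rfl).mul hΔm').add
        (((hH n).mono hle le_rfl).mul ((hΔm'.pow_const 2).sub_const D)))
    · change Integrable (fun ω => (S ω + (A n ω * Δ ω + H n ω * (Δ ω ^ 2 - D))) ^ 2) ℙ
      simp only [hexp]
      exact ((hSi.add (hcross1i.const_mul 2)).add (hcross2i.const_mul 2)).add hNi
    · change ∫ ω, (S ω + (A n ω * Δ ω + H n ω * (Δ ω ^ 2 - D))) ^ 2 ∂ℙ ≤ _
      simp only [hexp]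
      have hI0 : Integrable (fun ω => S ω ^ 2) ℙ := hSi
      have hI1 : Integrable (fun ω => S ω ^ 2 + 2 * (S ω * A n ω * Δ ω)) ℙ :=
        hI0.add (hcross1i.const_mul 2)
      have hI2 : Integrable (fun ω => S ω ^ 2 + 2 * (S ω * A n ω * Δ ω) +
          2 * (S ω * H n ω * (Δ ω ^ 2 - D))) ℙ := hI1.add (hcross2i.const_mul 2)
      rw [integral_add hI2 hNi, integral_add hI1 (hcross2i.const_mul 2),
        integral_add hI0 (hcross1i.const_mul 2), integral_const_mul, integral_const_mul,
        hcross1, hcross2]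
      linarith

namespace IsDrifted

variable {C x : ℝ} {X : ℝ → Ω → ℝ}

theorem measurable (hX : IsDrifted w C x X) (hw : IsWiener w) {t : ℝ} (ht : 0 ≤ t) :
    Measurable (X t) := (hX.adapted t ht).mono (hw.natSigma_le t) le_rfl

theorem ae_continuousOn (hX : IsDrifted w C x X) (hw : IsWiener w) :
    ∀ᵐ ω ∂(ℙ : Measure Ω), ContinuousOn (fun t => X t ω) (Ici 0) := by
  filter_upwards [hX.lip, hw.cont] with ω hlip hcont
  have hC : 0 ≤ C := by
    have := (abs_nonneg _).trans (hlip 0 1 le_rfl zero_le_one)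
    linarith
  have h1 : ContinuousOn (fun t => X t ω - w t ω) (Ici 0) := by
    refine (LipschitzOnWith.of_dist_le_mul (K := C.toNNReal) fun s hs t ht => ?_).continuousOn
    rw [Real.coe_toNNReal _ hC, Real.dist_eq, Real.dist_eq]
    rcases le_total s t with h | h
    · rw [abs_sub_comm, abs_sub_comm s t, abs_of_nonneg (sub_nonneg.2 h)]
      exact hlip s t hs h
    · rw [abs_of_nonneg (sub_nonneg.2 h)]
      exact hlip t s ht h
  exact (h1.add hcont.continuousOn).congr fun t _ => by simp

theorem ae_sq_sub_le (hX : IsDrifted w C x X) {t : ℝ} (ht : 0 ≤ t) :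
    ∀ᵐ ω ∂(ℙ : Measure Ω), (X t ω - x) ^ 2 ≤ 2 * C ^ 2 * t ^ 2 + 2 * (w t ω - w 0 ω) ^ 2 := by
  filter_upwards [hX.lip, hX.init] with ω hlip hinit
  have h := hlip 0 t le_rfl ht
  rw [hinit, sub_zero] at h
  have h2 := pow_le_pow_left₀ (abs_nonneg _) h 2
  rw [sq_abs] at h2
  nlinarith [sq_nonneg ((X t ω - w t ω - (x - w 0 ω)) - (w t ω - w 0 ω))]

theorem integrable_sq_sub (hX : IsDrifted w C x X) (hw : IsWiener w) {t : ℝ} (ht : 0 ≤ t) :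
    Integrable (fun ω => (X t ω - x) ^ 2) ℙ := by
  have := hw.isProb
  refine ((integrable_const (2 * C ^ 2 * t ^ 2)).add
    ((hw.integrable_sub_pow le_rfl ht 2).const_mul 2)).mono'
    (((hX.measurable hw ht).sub_const x).pow_const 2).aestronglyMeasurable ?_
  filter_upwards [hX.ae_sq_sub_le ht] with ω h
  rw [Real.norm_eq_abs, abs_of_nonneg (sq_nonneg _)]
  exact h

theorem integral_sq_sub_le (hX : IsDrifted w C x X) (hw : IsWiener w) {t : ℝ} (ht : 0 ≤ t) :
    ∫ ω, (X t ω - x) ^ 2 ∂ℙ ≤ 2 * C ^ 2 * t ^ 2 + 2 * t := by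
  have := hw.isProb
  have hi : Integrable (fun ω => 2 * (w t ω - w 0 ω) ^ 2) ℙ :=
    (hw.integrable_sub_pow le_rfl ht 2).const_mul 2
  refine (integral_mono_ae (hX.integrable_sq_sub hw ht) ((integrable_const _).add hi)
    (hX.ae_sq_sub_le ht)).trans (le_of_eq ?_)
  refine (integral_add (integrable_const _) hi).trans ?_
  rw [integral_const, integral_const_mul, hw.integral_sub_sq le_rfl ht]
  simp

end IsDrifted

end Drifted

section DiscreteIto

variable {Ω : Type*} [MeasureSpace Ω] {w : ℝ → Ω → ℝ}

theorem IsWiener.integral_sq_remainder_le (hw : IsWiener w) {C K M t : ℝ} (hC : 0 ≤ C)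
    (hK : 0 ≤ K) (hM : 0 ≤ M) :
    ∃ c, 0 ≤ c ∧ ∀ s r : ℝ, 0 ≤ s → s ≤ r → r - s ≤ t →
      Integrable (fun ω => (M * (|w r ω - w s ω| * (C * (r - s)) + (C * (r - s)) ^ 2) +
        K * (|w r ω - w s ω| + C * (r - s)) ^ 3) ^ 2) ℙ ∧
      ∫ ω, (M * (|w r ω - w s ω| * (C * (r - s)) + (C * (r - s)) ^ 2) +
        K * (|w r ω - w s ω| + C * (r - s)) ^ 3) ^ 2 ∂ℙ ≤ c * (r - s) ^ 3 := by
  set c₁ := M * C + M * C ^ 2 * √t + K * (1 + C * √t) ^ 3 with hc₁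
  have hc₁0 : 0 ≤ c₁ := by positivity
  have hZi : Integrable (fun z : ℝ => c₁ ^ 2 * (2 ^ 5 * (1 + |z| ^ 6))) (gaussianReal 0 1) :=
    (((integrable_const _).add (integrable_abs_pow_gaussianReal 6)).const_mul _).const_mul _
  refine ⟨∫ z, c₁ ^ 2 * (2 ^ 5 * (1 + |z| ^ 6)) ∂(gaussianReal 0 1),
    integral_nonneg fun z => by positivity, fun s r hs hsr hrt => ?_⟩
  have hD : 0 ≤ r - s := sub_nonneg.2 hsr
  set D := r - s with hDdef
  set Q : ℝ → ℝ := fun v => (M * (|v| * (C * D) + (C * D) ^ 2) + K * (|v| + C * D) ^ 3) ^ 2 with hQ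
  have hQm : Measurable Q := by fun_prop
  set ρ := √D with hρ
  have hρ0 : 0 ≤ ρ := Real.sqrt_nonneg _
  have hρD : D = ρ ^ 2 := (Real.sq_sqrt hD).symm
  have hρt : ρ ≤ √t := Real.sqrt_le_sqrt hrt
  have hle : ∀ z, Q (ρ * z) ≤ c₁ ^ 2 * (2 ^ 5 * (1 + |z| ^ 6)) * D ^ 3 := by
    intro z
    have hz := abs_nonneg z
    have h1 : M * (|ρ * z| * (C * D) + (C * D) ^ 2) + K * (|ρ * z| + C * D) ^ 3 ≤
        ρ ^ 3 * (c₁ * (1 + |z|) ^ 3) := by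
      rw [abs_mul, abs_of_nonneg hρ0, hρD]
      have e : M * (ρ * |z| * (C * ρ ^ 2) + (C * ρ ^ 2) ^ 2) + K * (ρ * |z| + C * ρ ^ 2) ^ 3 =
          ρ ^ 3 * (M * C * |z| + M * C ^ 2 * ρ * 1 + K * (|z| + C * ρ) ^ 3) := by ring
      rw [e]
      refine mul_le_mul_of_nonneg_left ?_ (by positivity)
      have hz1 : |z| ≤ (1 + |z|) ^ 3 := by nlinarith [pow_nonneg hz 2, pow_nonneg hz 3]
      have hz2 : 1 ≤ (1 + |z|) ^ 3 := by nlinarith [pow_nonneg hz 2, pow_nonneg hz 3]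
      have hz3 : (|z| + C * ρ) ^ 3 ≤ (1 + C * √t) ^ 3 * (1 + |z|) ^ 3 := by
        rw [← mul_pow]
        refine pow_le_pow_left₀ (by positivity) ?_ 3
        have := mul_le_mul_of_nonneg_left hρt hC
        nlinarith [mul_nonneg (mul_nonneg hC (Real.sqrt_nonneg t)) hz]
      calc _ ≤ M * C * (1 + |z|) ^ 3 + M * C ^ 2 * √t * (1 + |z|) ^ 3 +
            K * ((1 + C * √t) ^ 3 * (1 + |z|) ^ 3) := by gcongr
        _ = _ := by rw [hc₁]; ring
    have h6 : (1 + |z|) ^ 6 ≤ 2 ^ 5 * (1 + |z| ^ 6) := by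
      simpa using add_pow_le (zero_le_one' ℝ) hz 6
    calc Q (ρ * z) ≤ (ρ ^ 3 * (c₁ * (1 + |z|) ^ 3)) ^ 2 :=
          pow_le_pow_left₀ (by positivity) h1 2
      _ = c₁ ^ 2 * (1 + |z|) ^ 6 * D ^ 3 := by rw [hρD]; ring
      _ ≤ _ := by gcongr
  have hQi : Integrable (fun z => Q (ρ * z)) (gaussianReal 0 1) :=
    (hZi.mul_const (D ^ 3)).mono' (by fun_prop) (ae_of_all _ fun z => by
      rw [Real.norm_eq_abs, abs_of_nonneg (sq_nonneg _)]; exact hle z)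
  refine ⟨(hw.integrable_comp_sub_iff (G := Q) hs hsr hQm).2 hQi, ?_⟩
  rw [hw.integral_comp_sub (G := Q) hs hsr hQm, ← integral_mul_const]
  exact integral_mono hQi (hZi.mul_const (D ^ 3)) hle

theorem IsDrifted.nonneg {C x : ℝ} {X : ℝ → Ω → ℝ} (hX : IsDrifted w C x X) (hw : IsWiener w) :
    0 ≤ C := by
  have := hw.isProb
  obtain ⟨ω, h⟩ := hX.lip.exists
  have := (abs_nonneg _).trans (h 0 1 le_rfl zero_le_one)
  linarith

/-- A discrete form of Itô's formula for `f (X t)`, squared and integrated. -/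
theorem IsDrifted.integral_sq_riemann_sum_le (hw : IsWiener w) {C x : ℝ} {X : ℝ → Ω → ℝ}
    (hX : IsDrifted w C x X) {f p h : ℝ → ℝ} {b M K : ℝ}
    (hf : ∀ z, HasDerivAt f (p z) z) (hp : ∀ z, HasDerivAt p (h z) z)
    (hb : ∀ z, |p z| ≤ b) (hM : ∀ z, |h z| ≤ M) (hK : ∀ u v, |h u - h v| ≤ K * |u - v|) {t : ℝ} :
    ∃ κ, ∀ (n : ℕ) (D : ℝ), 0 ≤ D → (n : ℝ) * D = t →
      ∫ ω, (∑ i ∈ Finset.range n, h (X (i * D) ω) * D) ^ 2 ∂ℙ ≤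
        16 * ((∫ ω, (f (X t ω) - f x) ^ 2 ∂ℙ) +
          (C ^ 2 * t + 2) * (∫ ω, ∑ i ∈ Finset.range n, p (X (i * D) ω) ^ 2 * D ∂ℙ) + κ * D) := by
  have := hw.isProb
  have hC := hX.nonneg hw
  have hM0 : 0 ≤ M := (abs_nonneg _).trans (hM 0)
  have hK0 : 0 ≤ K := by simpa using (abs_nonneg _).trans (hK 1 0)
  obtain ⟨c, hc0, hc⟩ := hw.integral_sq_remainder_le (t := t) hC hK0 hM0
  set c₄ := ∫ z, (z ^ 2 - 1) ^ 2 ∂(gaussianReal 0 1)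
  refine ⟨M ^ 2 / 2 * c₄ * t + c * t ^ 2, fun n D hD hnD => ?_⟩
  have ht : 0 ≤ t := hnD ▸ by positivity
  have hfm : Measurable f := (continuous_iff_continuousAt.2 fun z => (hf z).continuousAt).measurable
  have hpm : Measurable p := (continuous_iff_continuousAt.2 fun z => (hp z).continuousAt).measurable
  have hhm : Measurable h := (LipschitzWith.of_dist_le_mul (K := K.toNNReal) fun u v => by
    rw [Real.coe_toNNReal _ hK0]; exact hK u v).continuous.measurable
  have hgrid : ∀ i : ℕ, (0 : ℝ) ≤ i * D := fun i => by positivity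
  have hstep : ∀ i : ℕ, (i : ℝ) * D ≤ (i + 1 : ℕ) * D := fun i => by push_cast; nlinarith
  have hstepD : ∀ i : ℕ, ((i + 1 : ℕ) : ℝ) * D - i * D = D := fun i => by push_cast; ring
  have hXm : ∀ i : ℕ, Measurable (X (i * D)) := fun i => hX.measurable hw (hgrid i)
  have hDt : ∀ i < n, D ≤ t := fun i hi => by
    have : (1 : ℝ) ≤ n := by exact_mod_cast (Nat.one_le_of_lt hi)
    nlinarith
  set Δ : ℕ → Ω → ℝ := fun i ω => w ((i + 1 : ℕ) * D) ω - w (i * D) ω with hΔ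
  set S : Ω → ℝ := fun ω => ∑ i ∈ Finset.range n,
    (p (X (i * D) ω) * Δ i ω + h (X (i * D) ω) / 2 * (Δ i ω ^ 2 - D)) with hS
  obtain ⟨-, hSi, hSle⟩ := memLp_two_and_integral_sq_sum_le hw hD
    (A := fun i ω => p (X (i * D) ω)) (H := fun i ω => h (X (i * D) ω) / 2) (b := b) (M := M / 2)
    (fun i => hpm.comp (hX.adapted _ (hgrid i)))
    (fun i => (hhm.comp (hX.adapted _ (hgrid i))).div_const 2) (fun i ω => hb _)
    (fun i ω => by rw [abs_div, abs_two]; gcongr; exact hM _) n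
  set R : ℕ → Ω → ℝ := fun i ω => M * (|Δ i ω| * (C * D) + (C * D) ^ 2) +
    K * (|Δ i ω| + C * D) ^ 3 with hR
  have hRi : ∀ i < n, Integrable (fun ω => R i ω ^ 2) ℙ ∧ ∫ ω, R i ω ^ 2 ∂ℙ ≤ c * D ^ 3 := by
    intro i hi
    have := hc (i * D) ((i + 1 : ℕ) * D) (hgrid i) (hstep i) (by rw [hstepD]; exact hDt i hi)
    rw [hstepD] at this
    exact this
  have hp2i : ∀ i : ℕ, Integrable (fun ω => p (X (i * D) ω) ^ 2) ℙ := fun i =>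
    Integrable.of_bound ((hpm.comp (hXm i)).pow_const 2).aestronglyMeasurable (b ^ 2)
      (ae_of_all _ fun ω => by
        rw [Real.norm_eq_abs, abs_pow]
        exact pow_le_pow_left₀ (abs_nonneg _) (hb _) 2)
  have hPi : Integrable (fun ω => ∑ i ∈ Finset.range n, p (X (i * D) ω) ^ 2 * D) ℙ :=
    integrable_finsetSum _ fun i _ => (hp2i i).mul_const D
  have hfi : Integrable (fun ω => (f (X t ω) - f x) ^ 2) ℙ := by
    refine ((hX.integrable_sq_sub hw ht).const_mul (b ^ 2)).mono'
      (((hfm.comp (hX.measurable hw ht)).sub_const _).pow_const 2).aestronglyMeasurable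
      (ae_of_all _ fun ω => ?_)
    rw [Real.norm_eq_abs, abs_pow, ← sq_abs (X t ω - x), ← mul_pow]
    exact pow_le_pow_left₀ (abs_nonneg _) (abs_sub_le_of_hasDerivAt hf hb _ _) 2
  have hRsi : Integrable (fun ω => n * ∑ i ∈ Finset.range n, R i ω ^ 2) ℙ :=
    (integrable_finsetSum _ fun i hi => (hRi i (Finset.mem_range.1 hi)).1).const_mul _
  have key : ∀ᵐ ω ∂(ℙ : Measure Ω), (∑ i ∈ Finset.range n, h (X (i * D) ω) * D) ^ 2 ≤
      16 * ((f (X t ω) - f x) ^ 2 + C ^ 2 * t * (∑ i ∈ Finset.range n, p (X (i * D) ω) ^ 2 * D) +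
        S ω ^ 2 + n * ∑ i ∈ Finset.range n, R i ω ^ 2) := by
    filter_upwards [hX.init, hX.lip] with ω hinit hlip
    set β : ℕ → ℝ := fun i => (X ((i + 1 : ℕ) * D) ω - w ((i + 1 : ℕ) * D) ω) -
      (X (i * D) ω - w (i * D) ω) with hβ
    have hβle : ∀ i, |β i| ≤ C * D := fun i => by
      have := hlip (i * D) ((i + 1 : ℕ) * D) (hgrid i) (hstep i)
      rwa [hstepD] at this
    set E : ℕ → ℝ := fun i => f (X ((i + 1 : ℕ) * D) ω) - f (X (i * D) ω) -
      p (X (i * D) ω) * β i - h (X (i * D) ω) / 2 * D -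
      (p (X (i * D) ω) * Δ i ω + h (X (i * D) ω) / 2 * (Δ i ω ^ 2 - D)) with hE
    have hEle : ∀ i, |E i| ≤ R i ω := by
      intro i
      have hT := abs_taylor_remainder_le hf hp hK (X (i * D) ω) (X ((i + 1 : ℕ) * D) ω)
      have hdX : X ((i + 1 : ℕ) * D) ω - X (i * D) ω = Δ i ω + β i := by
        simp only [hΔ, hβ]; ring
      rw [hdX] at hT
      have hEeq : E i = (f (X ((i + 1 : ℕ) * D) ω) - f (X (i * D) ω) -
          p (X (i * D) ω) * (Δ i ω + β i) - h (X (i * D) ω) / 2 * (Δ i ω + β i) ^ 2) +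
          h (X (i * D) ω) * (Δ i ω * β i + β i ^ 2 / 2) := by simp only [hE]; ring
      have h3 : K * |Δ i ω + β i| ^ 3 ≤ K * (|Δ i ω| + C * D) ^ 3 := by
        gcongr
        exact (abs_add_le _ _).trans (by linarith [hβle i])
      have hβ2 : β i ^ 2 ≤ (C * D) ^ 2 := by
        rw [← sq_abs]; exact pow_le_pow_left₀ (abs_nonneg _) (hβle i) 2
      have h4 : |h (X (i * D) ω) * (Δ i ω * β i + β i ^ 2 / 2)| ≤
          M * (|Δ i ω| * (C * D) + (C * D) ^ 2) := by
        rw [abs_mul]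
        refine mul_le_mul (hM _) ?_ (abs_nonneg _) hM0
        refine (abs_add_le _ _).trans (add_le_add ?_ ?_)
        · rw [abs_mul]; gcongr; exact hβle i
        · rw [abs_of_nonneg (by positivity)]; linarith [sq_nonneg (β i)]
      rw [hEeq]
      refine (abs_add_le _ _).trans ?_
      simp only [hR]
      linarith
    have htel : ∑ i ∈ Finset.range n, (f (X ((i + 1 : ℕ) * D) ω) - f (X (i * D) ω)) =
        f (X t ω) - f x := by
      rw [Finset.sum_range_sub (fun i : ℕ => f (X (i * D) ω)), hnD]
      simp [hinit]
    have hsum : (∑ i ∈ Finset.range n, h (X (i * D) ω) * D) / 2 = (f (X t ω) - f x) -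
        (∑ i ∈ Finset.range n, p (X (i * D) ω) * β i) - S ω - ∑ i ∈ Finset.range n, E i := by
      rw [← htel, hS, Finset.sum_div, ← Finset.sum_sub_distrib, ← Finset.sum_sub_distrib,
        ← Finset.sum_sub_distrib]
      refine Finset.sum_congr rfl fun i _ => ?_
      simp only [hE]; ring
    have hdrift : (∑ i ∈ Finset.range n, p (X (i * D) ω) * β i) ^ 2 ≤
        C ^ 2 * t * (∑ i ∈ Finset.range n, p (X (i * D) ω) ^ 2 * D) := by
      have h1 := sq_sum_le_card_mul_sum_sq (s := Finset.range n)
        (f := fun i => p (X (i * D) ω) * β i)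
      rw [Finset.card_range] at h1
      refine h1.trans ?_
      have h2 : ∑ i ∈ Finset.range n, (p (X (i * D) ω) * β i) ^ 2 ≤
          ∑ i ∈ Finset.range n, p (X (i * D) ω) ^ 2 * (C * D) ^ 2 := by
        refine Finset.sum_le_sum fun i _ => ?_
        rw [mul_pow]
        gcongr ?_ * ?_
        rw [← sq_abs]; exact pow_le_pow_left₀ (abs_nonneg _) (hβle i) 2
      refine (mul_le_mul_of_nonneg_left h2 (Nat.cast_nonneg n)).trans (le_of_eq ?_)
      rw [← Finset.sum_mul, ← Finset.sum_mul, ← hnD]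
      ring
    have herr : (∑ i ∈ Finset.range n, E i) ^ 2 ≤ n * ∑ i ∈ Finset.range n, R i ω ^ 2 := by
      have h1 := sq_sum_le_card_mul_sum_sq (s := Finset.range n) (f := E)
      rw [Finset.card_range] at h1
      refine h1.trans (mul_le_mul_of_nonneg_left (Finset.sum_le_sum fun i _ => ?_)
        (Nat.cast_nonneg n))
      rw [← sq_abs]; exact pow_le_pow_left₀ (abs_nonneg _) (hEle i) 2
    set a₁ := f (X t ω) - f x
    set a₂ := ∑ i ∈ Finset.range n, p (X (i * D) ω) * β i
    set a₄ := ∑ i ∈ Finset.range n, E i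
    have h4 : (∑ i ∈ Finset.range n, h (X (i * D) ω) * D) ^ 2 ≤
        16 * (a₁ ^ 2 + a₂ ^ 2 + S ω ^ 2 + a₄ ^ 2) := by
      have : (∑ i ∈ Finset.range n, h (X (i * D) ω) * D) = 2 * (a₁ - a₂ - S ω - a₄) := by
        linarith
      rw [this]
      nlinarith [sq_nonneg (a₁ + a₂), sq_nonneg (a₁ + S ω), sq_nonneg (a₁ + a₄),
        sq_nonneg (a₂ - S ω), sq_nonneg (a₂ - a₄), sq_nonneg (S ω - a₄)]
    linarith
  have hi1 : Integrable (fun ω => (f (X t ω) - f x) ^ 2 +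
      C ^ 2 * t * (∑ i ∈ Finset.range n, p (X (i * D) ω) ^ 2 * D)) ℙ :=
    hfi.add (hPi.const_mul _)
  have hSi' : Integrable (fun ω => S ω ^ 2) ℙ := hSi
  have hi2 : Integrable (fun ω => (f (X t ω) - f x) ^ 2 +
      C ^ 2 * t * (∑ i ∈ Finset.range n, p (X (i * D) ω) ^ 2 * D) + S ω ^ 2) ℙ := hi1.add hSi'
  have hmain := integral_mono_of_nonneg (ae_of_all _ fun ω => sq_nonneg _)
    ((hi2.add hRsi).const_mul 16) key
  refine hmain.trans ?_
  change ∫ ω, 16 * ((f (X t ω) - f x) ^ 2 +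
      C ^ 2 * t * (∑ i ∈ Finset.range n, p (X (i * D) ω) ^ 2 * D) + S ω ^ 2 +
        n * ∑ i ∈ Finset.range n, R i ω ^ 2) ∂ℙ ≤ _
  rw [integral_const_mul, integral_add hi2 hRsi, integral_add hi1 hSi',
    integral_add hfi (hPi.const_mul _), integral_const_mul, integral_const_mul,
    integral_finsetSum (s := Finset.range n) (f := fun i ω => R i ω ^ 2)
      fun i hi => (hRi i (Finset.mem_range.1 hi)).1]
  have hRsum : (n : ℝ) * ∑ i ∈ Finset.range n, ∫ ω, R i ω ^ 2 ∂ℙ ≤ c * t ^ 2 * D := by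
    have h1 : ∑ i ∈ Finset.range n, ∫ ω, R i ω ^ 2 ∂ℙ ≤ ∑ i ∈ Finset.range n, c * D ^ 3 :=
      Finset.sum_le_sum fun i hi => (hRi i (Finset.mem_range.1 hi)).2
    rw [Finset.sum_const, Finset.card_range, nsmul_eq_mul] at h1
    refine (mul_le_mul_of_nonneg_left h1 (Nat.cast_nonneg n)).trans (le_of_eq ?_)
    rw [← hnD]; ring
  have hSle' : ∫ ω, S ω ^ 2 ∂ℙ ≤
      2 * (∫ ω, ∑ i ∈ Finset.range n, p (X (i * D) ω) ^ 2 * D ∂ℙ) + M ^ 2 / 2 * c₄ * t * D := by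
    refine hSle.trans (le_of_eq ?_)
    rw [integral_finsetSum _ fun i _ => (hp2i i).mul_const D, Finset.sum_add_distrib,
      Finset.sum_const, Finset.card_range, nsmul_eq_mul, ← Finset.mul_sum]
    simp only [integral_mul_const]
    rw [← Finset.sum_mul, ← hnD]
    ring
  linarith

end DiscreteIto

section ContinuousIto

variable {Ω : Type*} [MeasureSpace Ω] {w : ℝ → Ω → ℝ}

theorem exists_measurable_version {X : ℝ → Ω → ℝ} (hm : ∀ t, 0 ≤ t → Measurable (X t))
    (hc : ∀ᵐ ω ∂(ℙ : Measure Ω), ContinuousOn (fun t => X t ω) (Ici 0)) :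
    ∃ X' : ℝ → Ω → ℝ, Measurable (Function.uncurry X') ∧
      ∀ᵐ ω ∂(ℙ : Measure Ω), ∀ t, 0 ≤ t → X' t ω = X t ω := by
  classical
  set N := toMeasurable (ℙ : Measure Ω) {ω | ¬ ContinuousOn (fun t => X t ω) (Ici 0)}
  have hN : MeasurableSet N := measurableSet_toMeasurable _ _
  have hN0 : (ℙ : Measure Ω) N = 0 := by rw [measure_toMeasurable]; exact ae_iff.1 hc
  refine ⟨fun t ω => if ω ∈ N then 0 else X (max t 0) ω,
    measurable_uncurry_of_continuous_of_measurable (fun ω => ?_)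
      fun t => Measurable.ite hN measurable_const (hm _ (le_max_right _ _)), ?_⟩
  · by_cases hω : ω ∈ N
    · simp only [hω, if_true]; exact continuous_const
    · simp only [hω, if_false]
      have hcω : ContinuousOn (fun t => X t ω) (Ici 0) := by
        by_contra h
        exact hω (subset_toMeasurable _ _ h)
      exact hcω.comp_continuous (by fun_prop) fun t => mem_Ici.2 (le_max_right t 0)
  · have : ∀ᵐ ω ∂(ℙ : Measure Ω), ω ∉ N := measure_eq_zero_iff_ae_notMem.1 hN0
    filter_upwards [this] with ω hω t ht
    simp [hω, max_eq_left ht]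

theorem aestronglyMeasurable_integral_comp {X : ℝ → Ω → ℝ} (hm : ∀ t, 0 ≤ t → Measurable (X t))
    (hc : ∀ᵐ ω ∂(ℙ : Measure Ω), ContinuousOn (fun t => X t ω) (Ici 0)) {u : ℝ → ℝ}
    (hu : Measurable u) {t : ℝ} (ht : 0 ≤ t) :
    AEStronglyMeasurable (fun ω => ∫ s in (0 : ℝ)..t, u (X s ω)) ℙ := by
  obtain ⟨X', hX'm, hX'⟩ := exists_measurable_version hm hc
  have h1 : StronglyMeasurable fun ω => ∫ s in Ioc 0 t, u (X' s ω) :=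
    StronglyMeasurable.integral_prod_left' (f := fun q : ℝ × Ω => u (X' q.1 q.2))
      (hu.comp hX'm).stronglyMeasurable
  refine h1.aestronglyMeasurable.congr ?_
  filter_upwards [hX'] with ω h
  rw [intervalIntegral.integral_of_le ht]
  refine setIntegral_congr_fun measurableSet_Ioc fun s hs => ?_
  simp only [h s hs.1.le]

theorem aestronglyMeasurable_comp_path {x : ℝ → ℝ} (hx : ContinuousOn x (Ici 0)) {u : ℝ → ℝ}
    (hu : Measurable u) {t : ℝ} (ht : 0 ≤ t) :
    AEStronglyMeasurable (fun s => u (x s)) (volume.restrict (uIoc 0 t)) := by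
  rw [uIoc_of_le ht]
  have h1 : AEMeasurable x (volume.restrict (Ioc 0 t)) :=
    (hx.mono fun s hs => hs.1.le).aemeasurable measurableSet_Ioc
  exact (hu.comp_aemeasurable h1).aestronglyMeasurable

theorem intervalIntegrable_comp_path {x : ℝ → ℝ} (hx : ContinuousOn x (Ici 0)) {u : ℝ → ℝ}
    (hu : Measurable u) {B : ℝ} (hB : ∀ z, |u z| ≤ B) {t : ℝ} (ht : 0 ≤ t) :
    IntervalIntegrable (fun s => u (x s)) volume 0 t := by
  have h1 : IntervalIntegrable (fun _ : ℝ => B) volume 0 t := intervalIntegrable_const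
  exact h1.mono_fun (aestronglyMeasurable_comp_path hx hu ht)
    (ae_of_all _ fun s => (hB _).trans (le_abs_self B))

theorem abs_integral_comp_path_le {x u : ℝ → ℝ} {B : ℝ} (hB : ∀ z, |u z| ≤ B) {t : ℝ}
    (ht : 0 ≤ t) : |∫ s in (0 : ℝ)..t, u (x s)| ≤ B * t := by
  have := intervalIntegral.norm_integral_le_of_norm_le_const (a := 0) (b := t)
    (f := fun s => u (x s)) (C := B) fun s _ => hB _
  simpa [abs_of_nonneg ht] using this

theorem tendsto_integral_comp_path {x : ℝ → ℝ} (hx : ContinuousOn x (Ici 0)) {u : ℕ → ℝ → ℝ}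
    {v : ℝ → ℝ} (hu : ∀ j, Measurable (u j)) {B : ℝ} (hB : ∀ j z, |u j z| ≤ B)
    (huv : ∀ z, Tendsto (fun j => u j z) atTop (nhds (v z))) {t : ℝ} (ht : 0 ≤ t) :
    Tendsto (fun j => ∫ s in (0 : ℝ)..t, u j (x s)) atTop (nhds (∫ s in (0 : ℝ)..t, v (x s))) :=
  intervalIntegral.tendsto_integral_filter_of_dominated_convergence (fun _ => B)
    (Eventually.of_forall fun j => aestronglyMeasurable_comp_path hx (hu j) ht)
    (Eventually.of_forall fun j => ae_of_all _ fun _ _ => hB j _)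
    intervalIntegrable_const (ae_of_all _ fun _ _ => huv _)

theorem tendsto_slope_one_div {g : ℝ → ℝ} {l z : ℝ} (hg : HasDerivWithinAt g l (Ioi z) z) :
    Tendsto (fun j : ℕ => (g (z + 1 / ((j : ℝ) + 1)) - g z) / (1 / ((j : ℝ) + 1))) atTop
      (nhds l) := by
  have h1 := (hasDerivWithinAt_iff_tendsto_slope' (by simp)).1 hg
  have h2 : Tendsto (fun j : ℕ => z + 1 / ((j : ℝ) + 1)) atTop (nhdsWithin z (Ioi z)) := by
    refine tendsto_nhdsWithin_iff.2 ⟨?_, Eventually.of_forall fun j => ?_⟩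
    · simpa using tendsto_one_div_add_atTop_nhds_zero_nat.const_add z
    · have : (0 : ℝ) < 1 / ((j : ℝ) + 1) := by positivity
      simp only [mem_Ioi]
      linarith
  refine (h1.comp h2).congr fun j => ?_
  simp [slope_def_field]

namespace IsDrifted

variable {C x : ℝ} {X : ℝ → Ω → ℝ}

theorem aestronglyMeasurable_integral (hX : IsDrifted w C x X) (hw : IsWiener w) {u : ℝ → ℝ}
    (hu : Measurable u) {t : ℝ} (ht : 0 ≤ t) :
    AEStronglyMeasurable (fun ω => ∫ s in (0 : ℝ)..t, u (X s ω)) ℙ :=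
  aestronglyMeasurable_integral_comp (fun _ h => hX.measurable hw h) (hX.ae_continuousOn hw) hu ht

theorem integrable_integral_pow (hX : IsDrifted w C x X) (hw : IsWiener w) {u : ℝ → ℝ}
    (hu : Measurable u) {B : ℝ} (hB : ∀ z, |u z| ≤ B) {t : ℝ} (ht : 0 ≤ t) (k : ℕ) :
    Integrable (fun ω => (∫ s in (0 : ℝ)..t, u (X s ω)) ^ k) ℙ := by
  have := hw.isProb
  refine Integrable.of_bound ((hX.aestronglyMeasurable_integral hw hu ht).pow k) ((B * t) ^ k)
    (ae_of_all _ fun ω => ?_)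
  rw [Real.norm_eq_abs, abs_pow]
  exact pow_le_pow_left₀ (abs_nonneg _) (abs_integral_comp_path_le hB ht) k

theorem tendsto_integral_integral_pow (hX : IsDrifted w C x X) (hw : IsWiener w) {u : ℕ → ℝ → ℝ}
    {v : ℝ → ℝ} (hu : ∀ j, Measurable (u j)) {B : ℝ} (hB : ∀ j z, |u j z| ≤ B)
    (huv : ∀ z, Tendsto (fun j => u j z) atTop (nhds (v z))) {t : ℝ} (ht : 0 ≤ t) (k : ℕ) :
    Tendsto (fun j => ∫ ω, (∫ s in (0 : ℝ)..t, u j (X s ω)) ^ k ∂ℙ) atTop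
      (nhds (∫ ω, (∫ s in (0 : ℝ)..t, v (X s ω)) ^ k ∂ℙ)) := by
  have := hw.isProb
  refine tendsto_integral_of_dominated_convergence (fun _ => (B * t) ^ k)
    (fun j => (hX.aestronglyMeasurable_integral hw (hu j) ht).pow k) (integrable_const _)
    (fun j => ae_of_all _ fun ω => ?_) ?_
  · rw [Real.norm_eq_abs, abs_pow]
    exact pow_le_pow_left₀ (abs_nonneg _) (abs_integral_comp_path_le (hB j) ht) k
  · filter_upwards [hX.ae_continuousOn hw] with ω hω
    exact (tendsto_integral_comp_path hω hu hB huv ht).pow k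

theorem tendsto_integral_riemann_sum_pow (hX : IsDrifted w C x X) (hw : IsWiener w) {u : ℝ → ℝ}
    (hu : Continuous u) {B : ℝ} (hB : ∀ z, |u z| ≤ B) {t : ℝ} (ht : 0 ≤ t) (k : ℕ) :
    Tendsto (fun m : ℕ => ∫ ω, (∑ i ∈ Finset.range (m + 1),
        u (X (i * (t / (m + 1))) ω) * (t / (m + 1))) ^ k ∂ℙ) atTop
      (nhds (∫ ω, (∫ s in (0 : ℝ)..t, u (X s ω)) ^ k ∂ℙ)) := by
  have := hw.isProb
  refine tendsto_integral_of_dominated_convergence (fun _ => (B * t) ^ k)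
    (fun m => ?_) (integrable_const _) (fun m => ae_of_all _ fun ω => ?_) ?_
  · refine ((Finset.measurable_fun_sum _ fun i _ => ?_).pow_const k).aestronglyMeasurable
    exact (hu.measurable.comp (hX.measurable hw (by positivity))).mul_const _
  · rw [Real.norm_eq_abs, abs_pow]
    refine pow_le_pow_left₀ (abs_nonneg _) ((Finset.abs_sum_le_sum_abs _ _).trans ?_) k
    have h1 : ∀ i ∈ Finset.range (m + 1), |u (X (i * (t / (m + 1))) ω) * (t / (m + 1))| ≤
        B * (t / (m + 1)) := fun i _ => by
      rw [abs_mul, abs_of_nonneg (a := t / ((m : ℝ) + 1)) (by positivity)]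
      gcongr
      exact hB _
    refine (Finset.sum_le_sum h1).trans (le_of_eq ?_)
    rw [Finset.sum_const, Finset.card_range, nsmul_eq_mul]
    push_cast
    field_simp
  · filter_upwards [hX.ae_continuousOn hw] with ω hω
    exact (tendsto_riemann_sum (u := fun s => u (X s ω)) ht
      ((hu.comp_continuousOn hω).mono Icc_subset_Ici_self)).pow k

theorem integral_sq_integral_le_of_lipschitz (hX : IsDrifted w C x X) (hw : IsWiener w)
    {f p h : ℝ → ℝ} {b M K : ℝ}
    (hf : ∀ z, HasDerivAt f (p z) z) (hp : ∀ z, HasDerivAt p (h z) z)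
    (hb : ∀ z, |p z| ≤ b) (hM : ∀ z, |h z| ≤ M) (hK : ∀ u v, |h u - h v| ≤ K * |u - v|) {t : ℝ}
    (ht : 0 ≤ t) :
    ∫ ω, (∫ s in (0 : ℝ)..t, h (X s ω)) ^ 2 ∂ℙ ≤
      16 * ((∫ ω, (f (X t ω) - f x) ^ 2 ∂ℙ) +
        (C ^ 2 * t + 2) * ∫ ω, ∫ s in (0 : ℝ)..t, p (X s ω) ^ 2 ∂ℙ) := by
  obtain ⟨κ, hκ⟩ := hX.integral_sq_riemann_sum_le hw hf hp hb hM hK (t := t)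
  have hK0 : 0 ≤ K := by simpa using (abs_nonneg _).trans (hK 1 0)
  have hpc : Continuous p := continuous_iff_continuousAt.2 fun z => (hp z).continuousAt
  have hhc : Continuous h := (LipschitzWith.of_dist_le_mul (K := K.toNNReal) fun u v => by
    rw [Real.coe_toNNReal _ hK0]; exact hK u v).continuous
  have hl := hX.tendsto_integral_riemann_sum_pow hw hhc hM ht 2
  have hr := hX.tendsto_integral_riemann_sum_pow hw (u := fun z => p z ^ 2) (hpc.pow 2) (B := b ^ 2)
    (fun z => by rw [abs_pow]; exact pow_le_pow_left₀ (abs_nonneg _) (hb z) 2) ht 1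
  simp only [pow_one] at hr
  have hD : Tendsto (fun m : ℕ => t / ((m : ℝ) + 1)) atTop (nhds 0) := by
    simpa [div_eq_mul_inv] using tendsto_one_div_add_atTop_nhds_zero_nat.const_mul t
  have hlim := (((hr.const_mul (C ^ 2 * t + 2)).const_add
    (∫ ω, (f (X t ω) - f x) ^ 2 ∂ℙ)).add (hD.const_mul κ)).const_mul 16
  rw [mul_zero, add_zero] at hlim
  refine le_of_tendsto_of_tendsto' hl hlim fun m => ?_
  have := hκ (m + 1) (t / (m + 1)) (by positivity) (by push_cast; field_simp)
  exact this

/-- An `L²` bound for additive functionals of `X` deduced from Itô's formula: `h` is only the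
right derivative of the Lipschitz function `p`. -/
theorem integral_sq_integral_le (hX : IsDrifted w C x X) (hw : IsWiener w)
    {f p h : ℝ → ℝ} {b M : ℝ}
    (hf : ∀ z, HasDerivAt f (p z) z) (hp : ∀ z, HasDerivWithinAt p (h z) (Ioi z) z)
    (hb : ∀ z, |p z| ≤ b) (hM : ∀ u v, |p u - p v| ≤ M * |u - v|) {t : ℝ} (ht : 0 ≤ t) :
    ∫ ω, (∫ s in (0 : ℝ)..t, h (X s ω)) ^ 2 ∂ℙ ≤
      16 * ((∫ ω, (f (X t ω) - f x) ^ 2 ∂ℙ) +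
        (C ^ 2 * t + 2) * ∫ ω, ∫ s in (0 : ℝ)..t, p (X s ω) ^ 2 ∂ℙ) := by
  have := hw.isProb
  have hfc : Continuous f := continuous_iff_continuousAt.2 fun z => (hf z).continuousAt
  have hM0 : 0 ≤ M := by simpa using (abs_nonneg _).trans (hM 1 0)
  have hpc : Continuous p := (LipschitzWith.of_dist_le_mul (K := M.toNNReal) fun u v => by
    rw [Real.coe_toNNReal _ hM0]; exact hM u v).continuous
  set F : ℝ → ℝ := fun z => ∫ y in (0 : ℝ)..z, f y
  have hF : ∀ z, HasDerivAt F (f z) z := fun z => (hfc.integral_hasStrictDerivAt 0 z).hasDerivAt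
  have hFc : Continuous F := continuous_iff_continuousAt.2 fun z => (hF z).continuousAt
  have hfl : ∀ u v, |f v - f u| ≤ b * |v - u| := abs_sub_le_of_hasDerivAt hf hb
  set δ : ℕ → ℝ := fun j => 1 / ((j : ℝ) + 1) with hδ
  have hδ0 : ∀ j, 0 < δ j := fun j => by positivity
  have hder : ∀ {g g' : ℝ → ℝ}, (∀ z, HasDerivAt g (g' z) z) → ∀ j z,
      HasDerivAt (fun z => (g (z + δ j) - g z) / δ j) ((g' (z + δ j) - g' z) / δ j) z :=
    fun hg j z => (((hg _).comp_add_const z (δ j)).sub (hg z)).div_const _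
  have hpj : ∀ j z, |(f (z + δ j) - f z) / δ j| ≤ b := fun j z => by
    rw [abs_div, abs_of_pos (hδ0 j), div_le_iff₀ (hδ0 j)]
    simpa [abs_of_pos (hδ0 j)] using hfl z (z + δ j)
  have hhj : ∀ j z, |(p (z + δ j) - p z) / δ j| ≤ M := fun j z => by
    rw [abs_div, abs_of_pos (hδ0 j), div_le_iff₀ (hδ0 j)]
    simpa [abs_of_pos (hδ0 j)] using hM (z + δ j) z
  have hhjl : ∀ j u v, |(p (u + δ j) - p u) / δ j - (p (v + δ j) - p v) / δ j| ≤
      2 * M / δ j * |u - v| := fun j u v => by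
    rw [← sub_div, abs_div, abs_of_pos (hδ0 j), div_le_iff₀ (hδ0 j)]
    have e : 2 * M / δ j * |u - v| * δ j = M * |(u + δ j) - (v + δ j)| + M * |u - v| := by
      have := (hδ0 j).ne'
      rw [add_sub_add_right_eq_sub]
      field_simp
      ring
    rw [e]
    calc _ = |(p (u + δ j) - p (v + δ j)) - (p u - p v)| := by ring_nf
      _ ≤ _ := (abs_sub _ _).trans (add_le_add (hM _ _) (hM _ _))
  have hfjl : ∀ j u v, |(F (v + δ j) - F v) / δ j - (F (u + δ j) - F u) / δ j| ≤ b * |v - u| :=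
    fun j => abs_sub_le_of_hasDerivAt (hder hF j) (hpj j)
  have hineq := fun j => hX.integral_sq_integral_le_of_lipschitz hw
    (f := fun z => (F (z + δ j) - F z) / δ j) (p := fun z => (f (z + δ j) - f z) / δ j)
    (h := fun z => (p (z + δ j) - p z) / δ j) (hder hF j) (hder hf j) (hpj j) (hhj j) (hhjl j) ht
  have hl := hX.tendsto_integral_integral_pow hw (u := fun j z => (p (z + δ j) - p z) / δ j)
    (v := h) (fun j => by fun_prop) hhj (fun z => tendsto_slope_one_div (hp z)) ht 2
  have hr := hX.tendsto_integral_integral_pow hw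
    (u := fun j z => ((f (z + δ j) - f z) / δ j) ^ 2) (v := fun z => p z ^ 2)
    (fun j => by fun_prop) (B := b ^ 2)
    (fun j z => by rw [abs_pow]; exact pow_le_pow_left₀ (abs_nonneg _) (hpj j z) 2)
    (fun z => (tendsto_slope_one_div (hf z).hasDerivWithinAt).pow 2) ht 1
  simp only [pow_one] at hr
  have hlim1 : Tendsto (fun j => ∫ ω, ((F (X t ω + δ j) - F (X t ω)) / δ j -
      (F (x + δ j) - F x) / δ j) ^ 2 ∂ℙ) atTop (nhds (∫ ω, (f (X t ω) - f x) ^ 2 ∂ℙ)) := by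
    have hXm := hX.measurable hw ht
    refine tendsto_integral_of_dominated_convergence (fun ω => b ^ 2 * (X t ω - x) ^ 2)
      (fun j => ?_) ((hX.integrable_sq_sub hw ht).const_mul _)
      (fun j => ae_of_all _ fun ω => ?_) (ae_of_all _ fun ω => ?_)
    · exact Measurable.aestronglyMeasurable (by fun_prop)
    · rw [Real.norm_eq_abs, abs_pow, ← sq_abs (X t ω - x), ← mul_pow]
      exact pow_le_pow_left₀ (abs_nonneg _) (hfjl j _ _) 2
    · exact ((tendsto_slope_one_div (hF _).hasDerivWithinAt).sub
        (tendsto_slope_one_div (hF _).hasDerivWithinAt)).pow 2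
  exact le_of_tendsto_of_tendsto' hl ((hlim1.add (hr.const_mul _)).const_mul 16) hineq

/-- The bound of `integral_sq_integral_le` in terms of `b = sup |p|` only. -/
theorem integral_sq_integral_le_sq (hX : IsDrifted w C x X) (hw : IsWiener w)
    {p h : ℝ → ℝ} {b M : ℝ} (hp : ∀ z, HasDerivWithinAt p (h z) (Ioi z) z)
    (hb : ∀ z, |p z| ≤ b) (hM : ∀ u v, |p u - p v| ≤ M * |u - v|) {t : ℝ} (ht : 0 ≤ t) :
    ∫ ω, (∫ s in (0 : ℝ)..t, h (X s ω)) ^ 2 ∂ℙ ≤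
      16 * ((2 * C ^ 2 * t ^ 2 + 2 * t) + (C ^ 2 * t + 2) * t) * b ^ 2 := by
  have := hw.isProb
  have hM0 : 0 ≤ M := by simpa using (abs_nonneg _).trans (hM 1 0)
  have hpc : Continuous p := (LipschitzWith.of_dist_le_mul (K := M.toNNReal) fun u v => by
    rw [Real.coe_toNNReal _ hM0]; exact hM u v).continuous
  set f : ℝ → ℝ := fun z => ∫ y in (0 : ℝ)..z, p y
  have hf : ∀ z, HasDerivAt f (p z) z := fun z => (hpc.integral_hasStrictDerivAt 0 z).hasDerivAt
  have hb2 : ∀ z, |p z ^ 2| ≤ b ^ 2 := fun z => by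
    rw [abs_pow]; exact pow_le_pow_left₀ (abs_nonneg _) (hb z) 2
  have h1 : ∫ ω, (f (X t ω) - f x) ^ 2 ∂ℙ ≤ b ^ 2 * (2 * C ^ 2 * t ^ 2 + 2 * t) := by
    refine le_trans ?_ (mul_le_mul_of_nonneg_left (hX.integral_sq_sub_le hw ht) (sq_nonneg b))
    rw [← integral_const_mul]
    refine integral_mono_of_nonneg (ae_of_all _ fun ω => sq_nonneg _)
      ((hX.integrable_sq_sub hw ht).const_mul _) (ae_of_all _ fun ω => ?_)
    simp only
    rw [← sq_abs, ← sq_abs (X t ω - x), ← mul_pow]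
    exact pow_le_pow_left₀ (abs_nonneg _) (abs_sub_le_of_hasDerivAt hf hb _ _) 2
  have h2 : ∫ ω, ∫ s in (0 : ℝ)..t, p (X s ω) ^ 2 ∂ℙ ≤ b ^ 2 * t := by
    have hi := hX.integrable_integral_pow hw (hpc.pow 2).measurable hb2 ht 1
    simp only [pow_one, Pi.pow_apply] at hi
    refine (integral_mono hi (integrable_const (b ^ 2 * t)) fun ω =>
      (le_abs_self _).trans (abs_integral_comp_path_le hb2 ht)).trans (by simp)
  have h3 := mul_le_mul_of_nonneg_left h2 (by positivity : 0 ≤ C ^ 2 * t + 2)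
  have := hX.integral_sq_integral_le hw hf hp hb hM ht
  linarith

end IsDrifted

end ContinuousIto

theorem integral_le_of_tendsto_ae {Ω : Type*} [MeasurableSpace Ω] {μ : Measure Ω}
    {F : ℕ → Ω → ℝ} {G : Ω → ℝ} {c : ℝ} (hF : ∀ j, Integrable (F j) μ) (h0 : ∀ j ω, 0 ≤ F j ω)
    (hc : ∀ᶠ j in atTop, ∫ ω, F j ω ∂μ ≤ c)
    (hFG : ∀ᵐ ω ∂μ, Tendsto (fun j => F j ω) atTop (nhds (G ω))) :
    Integrable G μ ∧ ∫ ω, G ω ∂μ ≤ c := by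
  have hGm : AEStronglyMeasurable G μ := aestronglyMeasurable_of_tendsto_ae atTop
    (fun j => (hF j).aestronglyMeasurable) hFG
  have hG0 : 0 ≤ᵐ[μ] G := by
    filter_upwards [hFG] with ω h
    exact ge_of_tendsto' h fun j => h0 j ω
  have hle : ∫⁻ ω, ENNReal.ofReal (G ω) ∂μ ≤ ENNReal.ofReal c := by
    calc ∫⁻ ω, ENNReal.ofReal (G ω) ∂μ
        = ∫⁻ ω, liminf (fun j => ENNReal.ofReal (F j ω)) atTop ∂μ := by
          refine lintegral_congr_ae ?_
          filter_upwards [hFG] with ω h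
          exact ((ENNReal.continuous_ofReal.tendsto _).comp h).liminf_eq.symm
      _ ≤ liminf (fun j => ∫⁻ ω, ENNReal.ofReal (F j ω) ∂μ) atTop :=
          lintegral_liminf_le' fun j => (hF j).aestronglyMeasurable.aemeasurable.ennreal_ofReal
      _ ≤ ENNReal.ofReal c := by
          refine liminf_le_of_frequently_le' (Eventually.frequently ?_)
          filter_upwards [hc] with j hj
          rw [← ofReal_integral_eq_lintegral_ofReal (hF j) (ae_of_all _ (h0 j))]
          exact ENNReal.ofReal_le_ofReal hj
  have hGi : Integrable G μ := by
    refine ⟨hGm, ?_⟩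
    rw [hasFiniteIntegral_iff_ofReal hG0]
    exact hle.trans_lt ENNReal.ofReal_lt_top
  refine ⟨hGi, ?_⟩
  obtain ⟨j, hj⟩ := hc.exists
  have hc0 : 0 ≤ c := (integral_nonneg (h0 j)).trans hj
  rwa [← ENNReal.ofReal_le_ofReal_iff hc0, ofReal_integral_eq_lintegral_ofReal hGi hG0]

section Clamp

variable {a ε : ℝ}

theorem clamp_mem_Icc (hε : 0 ≤ ε) (z : ℝ) : max 0 (min (z - a) ε) ∈ Icc 0 ε :=
  ⟨le_max_left _ _, max_le hε (min_le_right _ _)⟩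

theorem abs_clamp_sub_le (u v : ℝ) :
    |max 0 (min (u - a) ε) - max 0 (min (v - a) ε)| ≤ |u - v| := by
  refine (abs_max_sub_max_le_max _ _ _ _).trans ?_
  refine max_le (by simp) ((abs_min_sub_min_le_max _ _ _ _).trans (max_le ?_ ?_)) <;> simp

theorem hasDerivWithinAt_clamp (hε : 0 < ε) (z : ℝ) :
    HasDerivWithinAt (fun z => max 0 (min (z - a) ε))
      (indicator (Ico a (a + ε)) (fun _ => (1 : ℝ)) z) (Ioi z) z := by
  rcases lt_or_ge z a with h1 | h1
  · rw [indicator_of_notMem (by simp [h1])]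
    refine ((hasDerivAt_const z (0 : ℝ)).congr_of_eventuallyEq ?_).hasDerivWithinAt
    filter_upwards [Iio_mem_nhds h1] with u hu
    exact max_eq_left ((min_le_left _ _).trans (by linarith [mem_Iio.1 hu]))
  rcases lt_or_ge z (a + ε) with h2 | h2
  · rw [indicator_of_mem (show z ∈ Ico a (a + ε) from ⟨h1, h2⟩)]
    refine ((hasDerivAt_id z).sub_const a).hasDerivWithinAt.congr_of_eventuallyEq ?_ ?_
    · filter_upwards [self_mem_nhdsWithin, mem_nhdsWithin_of_mem_nhds (Iio_mem_nhds h2)]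
        with u hu hu2
      have := mem_Ioi.1 hu
      have := mem_Iio.1 hu2
      rw [min_eq_left (by linarith), max_eq_right (by linarith)]
      rfl
    · rw [min_eq_left (by linarith), max_eq_right (by linarith)]
      rfl
  · rw [indicator_of_notMem (by simp [h2])]
    have h3 : ∀ u, z ≤ u → max 0 (min (u - a) ε) = ε := fun u hu => by
      rw [min_eq_right (by linarith), max_eq_right hε.le]
    exact (hasDerivWithinAt_const z (Ioi z) ε).congr (fun u hu => h3 u (mem_Ioi.1 hu).le)
      (h3 z le_rfl)

end Clamp

section Occupation

variable {Ω : Type*} [MeasureSpace Ω] {w : ℝ → Ω → ℝ} {C x : ℝ} {X : ℝ → Ω → ℝ}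

/-- The constant in the `L²` bound `IsDrifted.integral_sq_integral_le_sq`. -/
def occupationConst (C t : ℝ) : ℝ := 16 * ((2 * C ^ 2 * t ^ 2 + 2 * t) + (C ^ 2 * t + 2) * t)

theorem occupationConst_nonneg {C t : ℝ} (ht : 0 ≤ t) : 0 ≤ occupationConst C t := by
  unfold occupationConst; positivity

theorem abs_indicator_one_le (s : Set ℝ) (z : ℝ) : |indicator s (fun _ => (1 : ℝ)) z| ≤ 1 := by
  by_cases h : z ∈ s <;> simp [h]

theorem indicator_one_nonneg (s : Set ℝ) (z : ℝ) : 0 ≤ indicator s (fun _ => (1 : ℝ)) z :=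
  indicator_nonneg (fun _ _ => zero_le_one) z

namespace IsDrifted

theorem integral_sq_occupation_le (hX : IsDrifted w C x X) (hw : IsWiener w) {t : ℝ} (ht : 0 ≤ t)
    (a : ℝ) {ε : ℝ} (hε : 0 < ε) :
    ∫ ω, (∫ s in (0 : ℝ)..t, indicator (Ico a (a + ε)) (fun _ => (1 : ℝ)) (X s ω)) ^ 2 ∂ℙ ≤
      occupationConst C t * ε ^ 2 :=
  hX.integral_sq_integral_le_sq hw (hasDerivWithinAt_clamp hε)
    (fun z => by
      rw [abs_of_nonneg (clamp_mem_Icc hε.le z).1]; exact (clamp_mem_Icc hε.le z).2)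
    (M := 1) (fun u v => by rw [one_mul]; exact abs_clamp_sub_le u v) ht

theorem integral_occupation_le (hX : IsDrifted w C x X) (hw : IsWiener w) {t : ℝ} (ht : 0 ≤ t)
    (a : ℝ) {ε : ℝ} (hε : 0 < ε) :
    ∫ ω, ∫ s in (0 : ℝ)..t, indicator (Ico a (a + ε)) (fun _ => (1 : ℝ)) (X s ω) ∂ℙ ≤
      (1 + occupationConst C t) * ε := by
  have := hw.isProb
  have hm : Measurable (indicator (Ico a (a + ε)) fun _ => (1 : ℝ)) :=
    measurable_const.indicator measurableSet_Ico
  have hi1 := hX.integrable_integral_pow hw hm (abs_indicator_one_le _) ht 1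
  have hi2 := hX.integrable_integral_pow hw hm (abs_indicator_one_le _) ht 2
  simp only [pow_one] at hi1
  calc _ ≤ ∫ ω, (ε + ε⁻¹ * (∫ s in (0 : ℝ)..t,
        indicator (Ico a (a + ε)) (fun _ => (1 : ℝ)) (X s ω)) ^ 2) ∂ℙ := by
        refine integral_mono hi1 ((integrable_const _).add (hi2.const_mul _)) fun ω => ?_
        set Y := ∫ s in (0 : ℝ)..t, indicator (Ico a (a + ε)) (fun _ => (1 : ℝ)) (X s ω)
        have h1 : ε + ε⁻¹ * Y ^ 2 - Y = ε⁻¹ * ((ε - Y / 2) ^ 2 + 3 / 4 * Y ^ 2) := by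
          field_simp; ring
        have h2 : 0 ≤ ε⁻¹ * ((ε - Y / 2) ^ 2 + 3 / 4 * Y ^ 2) := by positivity
        show Y ≤ ε + ε⁻¹ * Y ^ 2
        linarith
    _ = ε + ε⁻¹ * ∫ ω, (∫ s in (0 : ℝ)..t,
        indicator (Ico a (a + ε)) (fun _ => (1 : ℝ)) (X s ω)) ^ 2 ∂ℙ := by
        rw [integral_add (integrable_const _) (hi2.const_mul _), integral_const_mul]
        simp
    _ ≤ ε + ε⁻¹ * (occupationConst C t * ε ^ 2) := by
        gcongr
        exact hX.integral_sq_occupation_le hw ht a hε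
    _ = _ := by field_simp

/-- The process spends no time at a given point. -/
theorem ae_ae_ne (hX : IsDrifted w C x X) (hw : IsWiener w) {t : ℝ} (ht : 0 ≤ t) (a : ℝ) :
    ∀ᵐ ω ∂(ℙ : Measure Ω), ∀ᵐ s ∂(volume.restrict (Ioc 0 t)), X s ω ≠ a := by
  have := hw.isProb
  set u : ℝ → ℝ := indicator {a} fun _ => (1 : ℝ)
  have hum : Measurable u := measurable_const.indicator (measurableSet_singleton a)
  have hub : ∀ z, |u z| ≤ 1 := abs_indicator_one_le _
  have hi := hX.integrable_integral_pow hw hum hub ht 1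
  simp only [pow_one] at hi
  have h0 : ∀ ω, 0 ≤ ∫ s in (0 : ℝ)..t, u (X s ω) := fun ω =>
    intervalIntegral.integral_nonneg ht fun s _ => indicator_one_nonneg _ _
  have hle : ∀ ε : ℝ, 0 < ε → ∫ ω, ∫ s in (0 : ℝ)..t, u (X s ω) ∂ℙ ≤
      (1 + occupationConst C t) * ε := fun ε hε => by
    have hm : Measurable (indicator (Ico a (a + ε)) fun _ => (1 : ℝ)) :=
      measurable_const.indicator measurableSet_Ico
    have hi1 := hX.integrable_integral_pow hw hm (abs_indicator_one_le _) ht 1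
    simp only [pow_one] at hi1
    refine (integral_mono_ae hi hi1 ?_).trans (hX.integral_occupation_le hw ht a hε)
    filter_upwards [hX.ae_continuousOn hw] with ω hω
    refine intervalIntegral.integral_mono_on ht (intervalIntegrable_comp_path hω hum hub ht)
      (intervalIntegrable_comp_path hω hm (abs_indicator_one_le _) ht) fun s _ => ?_
    exact indicator_le_indicator_of_subset (by simp [hε]) (fun _ => zero_le_one) _
  have hz : ∫ ω, ∫ s in (0 : ℝ)..t, u (X s ω) ∂ℙ = 0 := by
    refine le_antisymm (le_of_forall_pos_le_add fun η hη => ?_) (integral_nonneg h0)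
    have hK : 0 < 1 + occupationConst C t := by linarith [occupationConst_nonneg (C := C) ht]
    have := hle (η / (1 + occupationConst C t)) (by positivity)
    rw [mul_div_cancel₀ _ hK.ne'] at this
    linarith
  have hz' := (integral_eq_zero_iff_of_nonneg h0 hi).1 hz
  filter_upwards [hz', hX.ae_continuousOn hw] with ω h hω
  have h' : ∫ s in Ioc 0 t, u (X s ω) = 0 := by
    rw [← intervalIntegral.integral_of_le ht]; exact h
  have hint := (intervalIntegrable_iff_integrableOn_Ioc_of_le ht).1
    (intervalIntegrable_comp_path hω hum hub ht)
  have h2 := (integral_eq_zero_iff_of_nonneg (fun s => indicator_one_nonneg {a} (X s ω)) hint).1 h'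
  filter_upwards [h2] with s hs ha
  simp [ha] at hs

end IsDrifted

end Occupation

section LocalTime

/-- `k` is a bump density on `[y, y + δ]` with distribution function `G`. -/
structure IsBump (y δ : ℝ) (G k : ℝ → ℝ) (B : ℝ) : Prop where
  hasDerivAt : ∀ z, HasDerivAt G (k z) z
  continuous : Continuous k
  bound : ∀ z, |k z| ≤ B
  lip : ∀ u v, |k u - k v| ≤ B * |u - v|
  mem_Icc : ∀ z, G z ∈ Icc (0 : ℝ) 1
  eq_zero : ∀ z, z ≤ y → G z = 0
  eq_one : ∀ z, y + δ ≤ z → G z = 1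

theorem exists_isBump (y : ℝ) {δ : ℝ} (hδ : 0 < δ) : ∃ G k B, IsBump y δ G k B := by
  set G : ℝ → ℝ := fun z => Real.smoothTransition ((z - y) / δ) with hG
  have hGs : ContDiff ℝ 2 G := Real.smoothTransition.contDiff.comp (by fun_prop)
  have hG0 : ∀ z, z ≤ y → G z = 0 := fun z hz =>
    Real.smoothTransition.zero_of_nonpos (div_nonpos_of_nonpos_of_nonneg (by linarith) hδ.le)
  have hG1 : ∀ z, y + δ ≤ z → G z = 1 := fun z hz =>
    Real.smoothTransition.one_of_one_le ((one_le_div hδ).2 (by linarith))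
  have hk : ContDiff ℝ 1 (deriv G) := hGs.deriv'
  have hks : HasCompactSupport (deriv G) := by
    refine HasCompactSupport.intro (isCompact_Icc (a := y) (b := y + δ)) fun z hz => ?_
    rw [mem_Icc, not_and_or, not_le, not_le] at hz
    rcases hz with hz | hz
    · have : G =ᶠ[nhds z] fun _ => 0 := by
        filter_upwards [Iio_mem_nhds hz] with u hu using hG0 u (mem_Iio.1 hu).le
      rw [this.deriv_eq, deriv_const]
    · have : G =ᶠ[nhds z] fun _ => 1 := by
        filter_upwards [Ioi_mem_nhds hz] with u hu using hG1 u (mem_Ioi.1 hu).le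
      rw [this.deriv_eq, deriv_const]
  obtain ⟨B, hB⟩ := hks.exists_bound_of_continuous hk.continuous
  obtain ⟨K, hK⟩ := ContDiff.lipschitzWith_of_hasCompactSupport hks hk one_ne_zero
  refine ⟨G, deriv G, max B K, fun z => (hGs.differentiable (by norm_num) z).hasDerivAt,
    hk.continuous, fun z => (hB z).trans (le_max_left _ _), fun u v => ?_,
    fun z => ⟨Real.smoothTransition.nonneg _, Real.smoothTransition.le_one _⟩, hG0, hG1⟩
  have := hK.dist_le_mul u v
  rw [Real.dist_eq, Real.dist_eq] at this
  exact this.trans (mul_le_mul_of_nonneg_right (le_max_right _ _) (abs_nonneg _))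

variable {Ω : Type*} [MeasureSpace Ω] {w : ℝ → Ω → ℝ} {C x : ℝ} {X : ℝ → Ω → ℝ}

/-- The constant in the rate of approximation of local times by smooth functionals. -/
def localTimeConst (C t : ℝ) : ℝ := (C ^ 2 * t + 2) * (1 + occupationConst C t)

theorem localTimeConst_nonneg {C t : ℝ} (ht : 0 ≤ t) : 0 ≤ localTimeConst C t := by
  have := occupationConst_nonneg (C := C) ht
  unfold localTimeConst; positivity

namespace IsDrifted

theorem integral_sq_indicator_sub_bump_le (hX : IsDrifted w C x X) (hw : IsWiener w) {t : ℝ}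
    (ht : 0 ≤ t) {y δ ε B : ℝ} {G k : ℝ → ℝ} (hδ : 0 < δ) (hk : IsBump y δ G k B) (hε : 0 < ε)
    (hεδ : ε ≤ δ) :
    ∫ ω, (1 / ε * (∫ s in (0 : ℝ)..t, indicator (Ico y (y + ε)) (fun _ => (1 : ℝ)) (X s ω)) -
        ∫ s in (0 : ℝ)..t, k (X s ω)) ^ 2 ∂ℙ ≤
      16 * (4 * δ ^ 2 + localTimeConst C t * δ) := by
  have := hw.isProb
  set c : ℝ → ℝ := fun z => max 0 (min (z - y) ε) with hc
  set p : ℝ → ℝ := fun z => 1 / ε * c z - G z with hp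
  set h : ℝ → ℝ := fun z => 1 / ε * indicator (Ico y (y + ε)) (fun _ => (1 : ℝ)) z - k z with hh
  have hB0 : 0 ≤ B := (abs_nonneg _).trans (hk.bound 0)
  have hpd : ∀ z, HasDerivWithinAt p (h z) (Ioi z) z := fun z =>
    ((hasDerivWithinAt_clamp hε z).const_mul _).sub (hk.hasDerivAt z).hasDerivWithinAt
  have hcI : ∀ z, 1 / ε * c z ∈ Icc (0 : ℝ) 1 := fun z => by
    obtain ⟨h1, h2⟩ := clamp_mem_Icc (a := y) hε.le z
    refine ⟨by positivity, ?_⟩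
    rw [one_div, inv_mul_le_iff₀ hε, mul_one]
    exact h2
  have hpb : ∀ z, |p z| ≤ 1 := fun z => by
    have h1 := hcI z
    have h2 := hk.mem_Icc z
    rw [abs_le]
    constructor <;> simp only [hp] <;> linarith [h1.1, h1.2, h2.1, h2.2]
  have hGl : ∀ u v, |G v - G u| ≤ B * |v - u| := abs_sub_le_of_hasDerivAt hk.hasDerivAt hk.bound
  have hpl : ∀ u v, |p u - p v| ≤ (1 / ε + B) * |u - v| := fun u v => by
    calc |p u - p v| = |1 / ε * (c u - c v) - (G u - G v)| := by simp only [hp]; ring_nf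
      _ ≤ |1 / ε * (c u - c v)| + |G u - G v| := abs_sub _ _
      _ ≤ 1 / ε * |u - v| + B * |u - v| := by
        rw [abs_mul, abs_of_pos (show 0 < 1 / ε by positivity)]
        exact add_le_add (mul_le_mul_of_nonneg_left (abs_clamp_sub_le u v) (by positivity))
          (hGl v u)
      _ = _ := by ring
  have hp0 : ∀ z, z ∉ Ico y (y + δ) → p z = 0 := fun z hz => by
    rw [mem_Ico, not_and_or, not_le, not_lt] at hz
    rcases hz with hz | hz
    · have : c z = 0 := max_eq_left ((min_le_left _ _).trans (by linarith))
      simp only [hp, this, hk.eq_zero z hz.le]; simp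
    · have : c z = ε := by
        simp only [hc]; rw [min_eq_right (by linarith), max_eq_right hε.le]
      simp only [hp, this, hk.eq_one z hz, one_div_mul_cancel hε.ne', sub_self]
  have hpc : Continuous p := (LipschitzWith.of_dist_le_mul (K := (1 / ε + B).toNNReal)
    fun u v => by rw [Real.coe_toNNReal _ (by positivity)]; exact hpl u v).continuous
  set f : ℝ → ℝ := fun z => ∫ u in y..z, p u with hf
  have hfd : ∀ z, HasDerivAt f (p z) z := fun z => (hpc.integral_hasStrictDerivAt y z).hasDerivAt
  have hpi : ∀ u v, |∫ z in u..v, p z| ≤ 1 * |v - u| := fun u v =>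
    intervalIntegral.norm_integral_le_of_norm_le_const (C := 1) fun z _ => by
      rw [Real.norm_eq_abs]; exact hpb z
  have hfb : ∀ z, |f z| ≤ δ := fun z => by
    rcases le_or_gt z y with hz | hz
    · have : f z = 0 := by
        simp only [hf]
        rw [intervalIntegral.integral_symm, intervalIntegral.integral_of_le hz,
          MeasureTheory.integral_Ioc_eq_integral_Ioo,
          setIntegral_congr_fun measurableSet_Ioo (g := fun _ => (0 : ℝ))
            fun u hu => hp0 u (by simp [hu.2])]
        simp
      rw [this, abs_zero]; exact hδ.le
    rcases le_or_gt z (y + δ) with hz2 | hz2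
    · refine (hpi _ _).trans ?_
      rw [one_mul, abs_of_pos (by linarith)]; linarith
    · have e : f z = ∫ u in y..(y + δ), p u := by
        simp only [hf]
        rw [← intervalIntegral.integral_add_adjacent_intervals (b := y + δ)
          (hpc.intervalIntegrable _ _) (hpc.intervalIntegrable _ _),
          intervalIntegral.integral_of_le hz2.le,
          setIntegral_congr_fun measurableSet_Ioc (g := fun _ => (0 : ℝ))
            fun u hu => hp0 u (by simp [hu.1.le])]
        simp
      rw [e]
      refine (hpi _ _).trans ?_
      rw [one_mul, add_sub_cancel_left, abs_of_pos hδ]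
  have hm : ∀ r, Measurable (indicator (Ico y (y + r)) fun _ => (1 : ℝ)) := fun r =>
    measurable_const.indicator measurableSet_Ico
  have key := hX.integral_sq_integral_le hw hfd hpd hpb hpl ht
  have e1 : ∫ ω, (∫ s in (0 : ℝ)..t, h (X s ω)) ^ 2 ∂ℙ = ∫ ω, (1 / ε * (∫ s in (0 : ℝ)..t,
      indicator (Ico y (y + ε)) (fun _ => (1 : ℝ)) (X s ω)) -
        ∫ s in (0 : ℝ)..t, k (X s ω)) ^ 2 ∂ℙ := by
    refine integral_congr_ae ?_
    filter_upwards [hX.ae_continuousOn hw] with ω hω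
    simp only [hh]
    rw [intervalIntegral.integral_sub
      ((intervalIntegrable_comp_path hω (hm ε) (abs_indicator_one_le _) ht).const_mul _)
      (intervalIntegrable_comp_path hω hk.continuous.measurable hk.bound ht),
      intervalIntegral.integral_const_mul]
  rw [← e1]
  refine key.trans (mul_le_mul_of_nonneg_left (add_le_add ?_ ?_) (by norm_num))
  · calc _ ≤ ∫ _, 4 * δ ^ 2 ∂(ℙ : Measure Ω) := by
          refine integral_mono_of_nonneg (ae_of_all _ fun ω => sq_nonneg _)
            (integrable_const _) (ae_of_all _ fun ω => ?_)
          have h1 := abs_le.1 (hfb (X t ω))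
          have h2 := abs_le.1 (hfb x)
          show (f (X t ω) - f x) ^ 2 ≤ 4 * δ ^ 2
          nlinarith
      _ = _ := by simp
  · have hC0 : 0 ≤ C ^ 2 * t + 2 := by positivity
    rw [localTimeConst, mul_assoc]
    refine mul_le_mul_of_nonneg_left (le_trans ?_ (hX.integral_occupation_le hw ht y hδ)) hC0
    have hi1 := hX.integrable_integral_pow hw (hm δ) (abs_indicator_one_le _) ht 1
    simp only [pow_one] at hi1
    refine integral_mono_of_nonneg (ae_of_all _ fun ω =>
      intervalIntegral.integral_nonneg ht fun s _ => sq_nonneg _) hi1 ?_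
    filter_upwards [hX.ae_continuousOn hw] with ω hω
    refine intervalIntegral.integral_mono_on ht
      (intervalIntegrable_comp_path hω (u := fun z => p z ^ 2) (hpc.pow 2).measurable (B := 1)
        (fun z => ?_) ht)
      (intervalIntegrable_comp_path hω (hm δ) (abs_indicator_one_le _) ht) fun s _ => ?_
    · rw [abs_pow]; exact pow_le_one₀ (abs_nonneg _) (hpb z)
    · by_cases hs : X s ω ∈ Ico y (y + δ)
      · rw [indicator_of_mem hs, ← sq_abs]
        exact pow_le_one₀ (abs_nonneg _) (hpb _)
      · rw [indicator_of_notMem hs, hp0 _ hs]; simp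

theorem integral_sq_localTime_sub_bump_le (hX : IsDrifted w C x X) (hw : IsWiener w) {t : ℝ}
    (ht : 0 ≤ t) {y δ B : ℝ} {G k : ℝ → ℝ} (hδ : 0 < δ) (hk : IsBump y δ G k B) {L : Ω → ℝ}
    (hL : ∀ᵐ ω ∂(ℙ : Measure Ω), IsLocalTime (fun s => X s ω) y t (L ω)) :
    Integrable (fun ω => (L ω - ∫ s in (0 : ℝ)..t, k (X s ω)) ^ 2) ℙ ∧
    ∫ ω, (L ω - ∫ s in (0 : ℝ)..t, k (X s ω)) ^ 2 ∂ℙ ≤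
      16 * (4 * δ ^ 2 + localTimeConst C t * δ) := by
  have := hw.isProb
  have hε : ∀ j : ℕ, (0 : ℝ) < 1 / ((j : ℝ) + 1) := fun j => by positivity
  have hm : ∀ r, Measurable (indicator (Ico y (y + r)) fun _ => (1 : ℝ)) := fun r =>
    measurable_const.indicator measurableSet_Ico
  refine integral_le_of_tendsto_ae (F := fun (j : ℕ) ω => (1 / (1 / ((j : ℝ) + 1)) *
    (∫ s in (0 : ℝ)..t, indicator (Ico y (y + 1 / ((j : ℝ) + 1))) (fun _ => (1 : ℝ)) (X s ω)) -
      ∫ s in (0 : ℝ)..t, k (X s ω)) ^ 2) (fun j => ?_) (fun j ω => sq_nonneg _) ?_ ?_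
  · refine Integrable.of_bound (C := (1 / (1 / ((j : ℝ) + 1)) * t + B * t) ^ 2)
      ((((hX.aestronglyMeasurable_integral hw (hm _) ht).const_mul _).sub
      (hX.aestronglyMeasurable_integral hw hk.continuous.measurable ht)).pow 2)
      (ae_of_all _ fun ω => ?_)
    rw [Real.norm_eq_abs, abs_pow]
    refine pow_le_pow_left₀ (abs_nonneg _) ((abs_sub _ _).trans (add_le_add ?_
      (abs_integral_comp_path_le hk.bound ht))) 2
    rw [abs_mul, abs_of_pos (show 0 < 1 / (1 / ((j : ℝ) + 1)) by positivity)]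
    refine mul_le_mul_of_nonneg_left ?_ (by positivity)
    simpa using abs_integral_comp_path_le (x := fun s => X s ω)
      (abs_indicator_one_le (Ico y (y + 1 / ((j : ℝ) + 1)))) ht
  · filter_upwards [tendsto_one_div_add_atTop_nhds_zero_nat.eventually (Iic_mem_nhds hδ)] with j hj
    exact hX.integral_sq_indicator_sub_bump_le hw ht hδ hk (hε j) hj
  · filter_upwards [hL] with ω h
    have h1 : Tendsto (fun j : ℕ => (1 : ℝ) / ((j : ℝ) + 1)) atTop (nhdsWithin 0 (Ioi 0)) :=
      tendsto_nhdsWithin_iff.2 ⟨tendsto_one_div_add_atTop_nhds_zero_nat,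
        Eventually.of_forall hε⟩
    exact ((h.comp h1).sub_const _).pow 2

end IsDrifted

end LocalTime

theorem CondC.exists_monotone_dominating {α : ℝ → ℝ} (hC : CondC α) :
    Measurable α ∧ ∃ (P : ℝ → ℝ) (V : ℝ), Monotone P ∧ (∀ z, |P z| ≤ V) ∧ (∀ z, |α z| ≤ V) ∧
      ∀ a b, |α a - α b| ≤ |P a - P b| := by
  have hl : LocallyBoundedVariationOn α univ := hC.locallyBoundedVariationOn
  set P := variationOnFromTo α univ 0 with hP
  have hPm : Monotone P := monotoneOn_univ.1 (variationOnFromTo.monotoneOn hl (mem_univ _))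
  have hQm : Monotone (P - α) :=
    monotoneOn_univ.1 (variationOnFromTo.sub_self_monotoneOn hl (mem_univ _))
  have hle : ∀ a b, a ≤ b → |α b - α a| ≤ P b - P a := fun a b hab =>
    variationOnFromTo.abs_sub_le_sub_of_le hl (mem_univ _) (mem_univ _) (mem_univ _) hab
  have hPb : ∀ z, |P z| ≤ (eVariationOn α univ).toReal := fun z =>
    variationOnFromTo.abs_le_eVariationOn hC
  have hdom : ∀ a b, |α a - α b| ≤ |P a - P b| := fun a b => by
    rcases le_total a b with h | h
    · rw [abs_sub_comm, abs_sub_comm (P a)]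
      exact (hle a b h).trans (le_abs_self _)
    · exact (hle b a h).trans (le_abs_self _)
  have hP0 : P 0 = 0 := variationOnFromTo.self _ _ _
  have hv : 0 ≤ (eVariationOn α univ).toReal := ENNReal.toReal_nonneg
  refine ⟨?_, P, (eVariationOn α univ).toReal + |α 0|, hPm,
    fun z => (hPb z).trans (by simp), fun z => ?_, hdom⟩
  · have : α = P - (P - α) := by simp
    rw [this]
    exact hPm.measurable.sub hQm.measurable
  · have h1 := hdom z 0
    rw [hP0, sub_zero] at h1
    have h2 := abs_sub_abs_le_abs_sub (α z) (α 0)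
    linarith [hPb z]

theorem abs_integral_le_of_abs_le {f b : ℝ → ℝ} (hb : Integrable b) (h : ∀ v, |f v| ≤ b v) :
    |∫ v, f v| ≤ ∫ v, b v := by
  rw [← Real.norm_eq_abs]
  exact norm_integral_le_of_norm_le hb (ae_of_all _ h)

section Mollify

variable {g : ℕ → ℝ → ℝ} {n : ℕ} {u : ℝ → ℝ} {V : ℝ}

namespace IsMollifier

theorem hasCompactSupport (hg : IsMollifier g) (hn : 1 ≤ n) : HasCompactSupport (g n) :=
  HasCompactSupport.intro (isCompact_Icc (a := -(1 / (n : ℝ))) (b := 1 / (n : ℝ)))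
    fun z hz => (hg n hn).2.2.1 z fun h => hz (Ioo_subset_Icc_self h)

theorem integrable (hg : IsMollifier g) (hn : 1 ≤ n) : Integrable (g n) :=
  (hg n hn).1.continuous.integrable_of_hasCompactSupport (hg.hasCompactSupport hn)

theorem mollify_eq (g : ℕ → ℝ → ℝ) (u : ℝ → ℝ) (n : ℕ) (z : ℝ) :
    mollify g u n z = ∫ v, g n v * u (z - v) := by
  rw [mollify, ← integral_sub_left_eq_self _ volume z]
  simp

theorem integrable_mul (hg : IsMollifier g) (hn : 1 ≤ n) (hu : Measurable u)
    (hV : ∀ z, |u z| ≤ V) (z : ℝ) : Integrable fun v => g n v * u (z - v) :=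
  (hg.integrable hn).mul_bdd (c := V)
    (hu.comp (measurable_const.sub measurable_id)).aestronglyMeasurable (ae_of_all _ fun _ => hV _)

theorem abs_mollify_sub_le (hg : IsMollifier g) (hn : 1 ≤ n) {c : ℝ}
    (hu : Measurable u) (hV : ∀ z, |u z| ≤ V) {z l : ℝ}
    (h : ∀ v ∈ Ioo (-(1 / (n : ℝ))) (1 / (n : ℝ)), |u (z - v) - l| ≤ c) :
    |mollify g u n z - l| ≤ c := by
  have hi := hg.integrable hn
  have e : mollify g u n z - l = ∫ v, g n v * (u (z - v) - l) := by
    simp only [mul_sub]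
    rw [mollify_eq, integral_sub (hg.integrable_mul hn hu hV z) (hi.mul_const l),
      integral_mul_const, (hg n hn).2.2.2, one_mul]
  rw [e]
  calc |∫ v, g n v * (u (z - v) - l)| ≤ ∫ v, g n v * c := by
        refine abs_integral_le_of_abs_le (hi.mul_const c) fun v => ?_
        have h0 := (hg n hn).2.1 v
        rw [abs_mul, abs_of_nonneg h0]
        by_cases hv : v ∈ Ioo (-(1 / (n : ℝ))) (1 / (n : ℝ))
        · exact mul_le_mul_of_nonneg_left (h v hv) h0
        · simp [(hg n hn).2.2.1 v hv]
    _ = c := by rw [integral_mul_const, (hg n hn).2.2.2, one_mul]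

theorem abs_mollify_le (hg : IsMollifier g) (hn : 1 ≤ n) (hu : Measurable u)
    (hV : ∀ z, |u z| ≤ V) (z : ℝ) : |mollify g u n z| ≤ V := by
  simpa using hg.abs_mollify_sub_le hn hu hV (z := z) (l := 0) fun v _ => by simpa using hV (z - v)

theorem tendsto_mollify (hg : IsMollifier g) (hu : Measurable u) (hV : ∀ z, |u z| ≤ V) {z : ℝ}
    (hz : ContinuousAt u z) : Tendsto (fun n => mollify g u n z) atTop (nhds (u z)) := by
  rw [Metric.tendsto_atTop]
  intro ε hε
  obtain ⟨δ, hδ, h⟩ := Metric.continuousAt_iff.1 hz (ε / 2) (half_pos hε)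
  obtain ⟨N, hN⟩ := exists_nat_one_div_lt hδ
  refine ⟨N + 1, fun n hn => ?_⟩
  refine lt_of_le_of_lt (hg.abs_mollify_sub_le (by omega) hu hV (c := ε / 2) fun v hv => ?_)
    (half_lt_self hε)
  refine (h ?_).le
  have h1 : 1 / (n : ℝ) ≤ 1 / ((N : ℝ) + 1) :=
    one_div_le_one_div_of_le (by positivity) (by exact_mod_cast hn)
  rw [Real.dist_eq, abs_lt]
  constructor <;> linarith [hv.1, hv.2]

theorem abs_mollify_sub_mollify_le (hg : IsMollifier g) (hn : 1 ≤ n) {P : ℝ → ℝ}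
    (hP : Monotone P) (hu : Measurable u) (hV : ∀ z, |u z| ≤ V) (hPV : ∀ z, |P z| ≤ V)
    (h : ∀ a b, |u a - u b| ≤ |P a - P b|) (a b : ℝ) :
    |mollify g u n a - mollify g u n b| ≤ |mollify g P n a - mollify g P n b| := by
  wlog hab : b ≤ a
  · rw [abs_sub_comm, abs_sub_comm (mollify g P n a)]
    exact this hg hn hP hu hV hPV h b a (le_of_not_ge hab)
  have hPm := hP.measurable
  simp only [mollify_eq]
  rw [← integral_sub (hg.integrable_mul hn hu hV a) (hg.integrable_mul hn hu hV b),
    ← integral_sub (hg.integrable_mul hn hPm hPV a) (hg.integrable_mul hn hPm hPV b)]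
  refine le_trans (abs_integral_le_of_abs_le ((hg.integrable_mul hn hPm hPV a).sub
    (hg.integrable_mul hn hPm hPV b)) fun v => ?_) (le_abs_self _)
  have h0 := (hg n hn).2.1 v
  rw [Pi.sub_apply]
  rw [← mul_sub, ← mul_sub, abs_mul, abs_of_nonneg h0]
  refine mul_le_mul_of_nonneg_left ((h _ _).trans ?_) h0
  rw [abs_of_nonneg (sub_nonneg.2 (hP (by linarith)))]

theorem monotone_mollify (hg : IsMollifier g) (hn : 1 ≤ n) {P : ℝ → ℝ}
    (hP : Monotone P) (hPV : ∀ z, |P z| ≤ V) : Monotone (mollify g P n) := fun a b hab => by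
  simp only [mollify_eq]
  refine integral_mono (hg.integrable_mul hn hP.measurable hPV a)
    (hg.integrable_mul hn hP.measurable hPV b) fun v => ?_
  exact mul_le_mul_of_nonneg_left (hP (by linarith)) ((hg n hn).2.1 v)

theorem exists_hasDerivAt_mollify (hg : IsMollifier g) (hn : 1 ≤ n) (hu : Measurable u)
    (hV : ∀ z, |u z| ≤ V) : ∃ (u' : ℝ → ℝ) (K : ℝ), Continuous u' ∧ (∀ z, |u' z| ≤ K) ∧
      ∀ z, HasDerivAt (mollify g u n) (u' z) z := by
  have hs := hg.hasCompactSupport hn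
  have hC := (hg n hn).1
  have hul : LocallyIntegrable u := by
    refine (locallyIntegrable_const V).mono hu.aestronglyMeasurable (ae_of_all _ fun z => ?_)
    exact (hV z).trans (le_abs_self V)
  have hdc : Continuous (deriv (g n)) := hC.continuous_deriv le_rfl
  have e : mollify g u n = convolution u (g n) (ContinuousLinearMap.mul ℝ ℝ) volume := by
    funext z
    simp only [mollify, convolution, ContinuousLinearMap.mul_apply', mul_comm]
  refine ⟨convolution u (deriv (g n)) (ContinuousLinearMap.mul ℝ ℝ) volume,
    V * ∫ v, |deriv (g n) v|, hs.deriv.continuous_convolution_right _ hul hdc, fun z => ?_,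
    fun z => e ▸ hs.hasDerivAt_convolution_right _ hul hC z⟩
  have hi : Integrable fun v => |deriv (g n) v| :=
    (hdc.integrable_of_hasCompactSupport hs.deriv).norm
  rw [convolution, ← integral_sub_left_eq_self _ volume z, ← integral_const_mul]
  refine abs_integral_le_of_abs_le (hi.const_mul V) fun v => ?_
  simp only [ContinuousLinearMap.mul_apply', sub_sub_cancel, abs_mul]
  exact mul_le_mul_of_nonneg_right (hV _) (abs_nonneg _)

end IsMollifier

end Mollify

section Stability

/-- Grönwall's inequality with a variable coefficient. -/
theorem le_mul_exp_of_le_integral {d A : ℝ → ℝ} {R t : ℝ} (hd : Continuous d) (hA : Continuous A)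
    (hA0 : ∀ s, 0 ≤ A s) (h : ∀ s ∈ Icc 0 t, d s ≤ R + ∫ u in (0 : ℝ)..s, A u * d u) :
    ∀ s ∈ Icc 0 t, d s ≤ R * Real.exp (∫ u in (0 : ℝ)..s, A u) := by
  intro s hs
  set E : ℝ → ℝ := fun s => ∫ u in (0 : ℝ)..s, A u
  set G : ℝ → ℝ := fun s => R + ∫ u in (0 : ℝ)..s, A u * d u
  have hE : ∀ s, HasDerivAt E (A s) s := fun s => (hA.integral_hasStrictDerivAt 0 s).hasDerivAt
  have hG : ∀ s, HasDerivAt G (A s * d s) s := fun s =>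
    (((hA.mul hd).integral_hasStrictDerivAt 0 s).hasDerivAt).const_add R
  have hH : ∀ s, HasDerivAt (fun s => G s * Real.exp (-E s))
      (A s * d s * Real.exp (-E s) + G s * (Real.exp (-E s) * -A s)) s := fun s =>
    (hG s).mul (hE s).neg.exp
  have hanti : AntitoneOn (fun s => G s * Real.exp (-E s)) (Icc 0 t) := by
    refine antitoneOn_of_deriv_nonpos (convex_Icc 0 t)
      (fun s _ => (hH s).continuousAt.continuousWithinAt)
      (fun s _ => (hH s).differentiableAt.differentiableWithinAt) fun s hs => ?_
    rw [(hH s).deriv]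
    have h1 : 0 ≤ A s * Real.exp (-E s) * (G s - d s) :=
      mul_nonneg (mul_nonneg (hA0 s) (Real.exp_pos _).le)
        (sub_nonneg.2 (h s (interior_subset hs)))
    linarith [h1]
  have h1 := hanti (left_mem_Icc.2 (hs.1.trans hs.2)) hs hs.1
  have h2 : G 0 * Real.exp (-E 0) = R := by simp [G, E]
  simp only [h2] at h1
  calc d s ≤ G s := h s hs
    _ = G s * Real.exp (-E s) * Real.exp (E s) := by
      rw [mul_assoc, ← Real.exp_add, neg_add_cancel, Real.exp_zero, mul_one]
    _ ≤ R * Real.exp (E s) := mul_le_mul_of_nonneg_right h1 (Real.exp_pos _).le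

theorem sub_eq_mul_integral_segment {Q q : ℝ → ℝ} (hQ : ∀ z, HasDerivAt Q (q z) z)
    (hq : Continuous q) (a b : ℝ) :
    Q b - Q a = (b - a) * ∫ θ in (0 : ℝ)..1, q (θ * b + (1 - θ) * a) := by
  have h1 : ∀ θ : ℝ, HasDerivAt (fun θ => Q (θ * b + (1 - θ) * a))
      (q (θ * b + (1 - θ) * a) * (b - a)) θ := fun θ => by
    have h2 : HasDerivAt (fun θ : ℝ => θ * b + (1 - θ) * a) (1 * b + (-1) * a) θ :=
      ((hasDerivAt_id θ).mul_const b).add (((hasDerivAt_id θ).const_sub 1).mul_const a)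
    have := (hQ (θ * b + (1 - θ) * a)).comp θ h2
    rwa [show 1 * b + (-1) * a = b - a by ring] at this
  have h3 := intervalIntegral.integral_eq_sub_of_hasDerivAt (a := 0) (b := 1) (fun θ _ => h1 θ)
    (Continuous.intervalIntegrable (by fun_prop) _ _)
  rw [intervalIntegral.integral_mul_const] at h3
  rw [mul_comm, h3]
  simp

theorem abs_sub_le_of_dominated {X Y W u v Q q : ℝ → ℝ} {x M t : ℝ}
    (hXc : ContinuousOn X (Ici 0)) (hYc : ContinuousOn Y (Ici 0))
    (hu : Measurable u) (hv : Measurable v) (huM : ∀ z, |u z| ≤ M) (hvM : ∀ z, |v z| ≤ M)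
    (hX : ∀ s, 0 ≤ s → X s = x + (∫ r in (0 : ℝ)..s, u (X r)) + W s)
    (hY : ∀ s, 0 ≤ s → Y s = x + (∫ r in (0 : ℝ)..s, v (Y r)) + W s)
    (hQ : ∀ z, HasDerivAt Q (q z) z) (hq : Continuous q) (hq0 : ∀ z, 0 ≤ q z)
    (hvQ : ∀ a b, |v a - v b| ≤ |Q a - Q b|) {s : ℝ} (hs : s ∈ Icc 0 t) :
    |Y s - X s| ≤ (∫ r in (0 : ℝ)..t, |v (X r) - u (X r)|) *
      Real.exp (∫ θ in (0 : ℝ)..1, ∫ r in (0 : ℝ)..t, q (θ * Y r + (1 - θ) * X r)) := by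
  have ht : 0 ≤ t := hs.1.trans hs.2
  set X' : ℝ → ℝ := fun s => X (max s 0) with hX'
  set Y' : ℝ → ℝ := fun s => Y (max s 0) with hY'
  have hXc' : Continuous X' := hXc.comp_continuous (by fun_prop) fun s => le_max_right s 0
  have hYc' : Continuous Y' := hYc.comp_continuous (by fun_prop) fun s => le_max_right s 0
  have hXe : ∀ s, 0 ≤ s → X' s = X s := fun s hs => by simp only [hX', max_eq_left hs]
  have hYe : ∀ s, 0 ≤ s → Y' s = Y s := fun s hs => by simp only [hY', max_eq_left hs]
  set A : ℝ → ℝ := fun s => ∫ θ in (0 : ℝ)..1, q (θ * Y' s + (1 - θ) * X' s) with hA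
  have hFc : Continuous (Function.uncurry fun s θ => q (θ * Y' s + (1 - θ) * X' s)) := by
    unfold Function.uncurry; fun_prop
  have hAc : Continuous A :=
    intervalIntegral.continuous_parametric_intervalIntegral_of_continuous' hFc 0 1
  have hA0 : ∀ s, 0 ≤ A s := fun s =>
    intervalIntegral.integral_nonneg zero_le_one fun θ _ => hq0 _
  set R := ∫ r in (0 : ℝ)..t, |v (X r) - u (X r)| with hR
  have hvuX : ∀ {s : ℝ}, 0 ≤ s → IntervalIntegrable (fun r => v (X r) - u (X r)) volume 0 s :=
    fun h => (intervalIntegrable_comp_path hXc hv hvM h).sub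
      (intervalIntegrable_comp_path hXc hu huM h)
  have hR0 : 0 ≤ R := intervalIntegral.integral_nonneg ht fun r _ => abs_nonneg _
  have hmain : ∀ s ∈ Icc 0 t, |Y' s - X' s| ≤ R + ∫ r in (0 : ℝ)..s, A r * |Y' r - X' r| := by
    intro s hs
    have hi1 := intervalIntegrable_comp_path hYc hv hvM hs.1
    have hi2 := intervalIntegrable_comp_path hXc hu huM hs.1
    have hi3 := intervalIntegrable_comp_path hXc hv hvM hs.1
    have e : Y' s - X' s = (∫ r in (0 : ℝ)..s, (v (Y r) - v (X r))) +
        ∫ r in (0 : ℝ)..s, (v (X r) - u (X r)) := by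
      rw [hXe s hs.1, hYe s hs.1, hX s hs.1, hY s hs.1, intervalIntegral.integral_sub hi1 hi3,
        intervalIntegral.integral_sub hi3 hi2]
      ring
    rw [e, add_comm R]
    refine (abs_add_le _ _).trans (add_le_add ?_ ?_)
    · refine (intervalIntegral.abs_integral_le_integral_abs hs.1).trans ?_
      refine intervalIntegral.integral_mono_on hs.1 (hi1.sub hi3).abs
        (Continuous.intervalIntegrable (by fun_prop) _ _) fun r hr => ?_
      rw [← hXe r hr.1, ← hYe r hr.1, ← abs_of_nonneg (hA0 r), ← abs_mul, mul_comm,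
        ← sub_eq_mul_integral_segment hQ hq]
      exact hvQ _ _
    · refine (intervalIntegral.abs_integral_le_integral_abs hs.1).trans ?_
      exact intervalIntegral.integral_mono_interval le_rfl hs.1 hs.2
        (ae_of_all _ fun r => abs_nonneg _) (hvuX ht).abs
  have hg := le_mul_exp_of_le_integral (d := fun s => |Y' s - X' s|) (by fun_prop) hAc hA0 hmain s hs
  simp only [hXe s hs.1, hYe s hs.1] at hg
  refine hg.trans (mul_le_mul_of_nonneg_left (Real.exp_le_exp.2 ?_) hR0)
  calc ∫ r in (0 : ℝ)..s, A r ≤ ∫ r in (0 : ℝ)..t, A r :=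
        intervalIntegral.integral_mono_interval le_rfl hs.1 hs.2 (ae_of_all _ hA0)
          (hAc.intervalIntegrable _ _)
    _ = ∫ θ in (0 : ℝ)..1, ∫ r in (0 : ℝ)..t, q (θ * Y' r + (1 - θ) * X' r) := by
        refine intervalIntegral_intervalIntegral_swap ?_
        refine (hFc.continuousOn.integrableOn_compact
          ((isCompact_uIcc (a := (0 : ℝ)) (b := t)).prod
            (isCompact_uIcc (a := (0 : ℝ)) (b := 1)))).mono_set ?_
        exact prod_mono uIoc_subset_uIcc uIoc_subset_uIcc
    _ = _ := by
        refine intervalIntegral.integral_congr fun θ _ => ?_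
        refine intervalIntegral.integral_congr fun r hr => ?_
        rw [uIcc_of_le ht] at hr
        simp only [hXe r hr.1, hYe r hr.1]

end Stability

section Drift

variable {Ω : Type*} [MeasureSpace Ω] {w : ℝ → Ω → ℝ} {C x : ℝ} {X Y : ℝ → Ω → ℝ}

theorem IsStrongSolution.isDrifted {α : ℝ → ℝ} (hX : IsStrongSolution α w x X)
    (hα : Measurable α) (hC : ∀ z, |α z| ≤ C) : IsDrifted w C x X where
  adapted := hX.adapted
  init := ae_of_all _ hX.init
  lip := by
    filter_upwards [hX.cont, hX.sde] with ω hc h s t hs hst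
    have ht := hs.trans hst
    have e : (X t ω - w t ω) - (X s ω - w s ω) = ∫ r in s..t, α (X r ω) := by
      rw [← intervalIntegral.integral_interval_sub_left
        (intervalIntegrable_comp_path hc hα hC ht) (intervalIntegrable_comp_path hc hα hC hs),
        h t ht, h s hs]
      ring
    rw [e]
    have := intervalIntegral.norm_integral_le_of_norm_le_const (a := s) (b := t)
      (f := fun r => α (X r ω)) (C := C) fun r _ => hC _
    rwa [abs_of_nonneg (sub_nonneg.2 hst)] at this

theorem IsDrifted.convexCombo (hX : IsDrifted w C x X) (hY : IsDrifted w C x Y) {θ : ℝ}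
    (hθ : θ ∈ Icc (0 : ℝ) 1) : IsDrifted w C x fun s ω => θ * Y s ω + (1 - θ) * X s ω where
  adapted := fun t ht => ((hY.adapted t ht).const_mul θ).add ((hX.adapted t ht).const_mul (1 - θ))
  init := by
    filter_upwards [hX.init, hY.init] with ω h1 h2
    rw [h1, h2]; ring
  lip := by
    filter_upwards [hX.lip, hY.lip] with ω h1 h2 s t hs hst
    have h1 := h1 s t hs hst
    have h2 := h2 s t hs hst
    have h3 : 0 ≤ 1 - θ := by linarith [hθ.2]
    calc _ = |θ * ((Y t ω - w t ω) - (Y s ω - w s ω)) +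
          (1 - θ) * ((X t ω - w t ω) - (X s ω - w s ω))| := by ring_nf
      _ ≤ θ * |(Y t ω - w t ω) - (Y s ω - w s ω)| +
          (1 - θ) * |(X t ω - w t ω) - (X s ω - w s ω)| := by
        refine (abs_add_le _ _).trans (le_of_eq ?_)
        rw [abs_mul, abs_mul, abs_of_nonneg hθ.1, abs_of_nonneg h3]
      _ ≤ θ * (C * (t - s)) + (1 - θ) * (C * (t - s)) :=
        add_le_add (mul_le_mul_of_nonneg_left h2 hθ.1) (mul_le_mul_of_nonneg_left h1 h3)
      _ = _ := by ring

/-- A bound, depending on `q` only through `V = sup |Q|`, for the functional of the difference of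
two processes. -/
theorem IsDrifted.integral_segment_le (hX : IsDrifted w C x X) (hY : IsDrifted w C x Y)
    (hw : IsWiener w) {Q q : ℝ → ℝ} {V K : ℝ} (hQ : ∀ z, HasDerivAt Q (q z) z) (hq : Continuous q)
    (hq0 : ∀ z, 0 ≤ q z) (hK : ∀ z, |q z| ≤ K) (hV : ∀ z, |Q z| ≤ V) {t : ℝ} (ht : 0 ≤ t) :
    Integrable (fun ω => ∫ θ in (0 : ℝ)..1, ∫ r in (0 : ℝ)..t,
      q (θ * Y r ω + (1 - θ) * X r ω)) ℙ ∧
    ∫ ω, ∫ θ in (0 : ℝ)..1, ∫ r in (0 : ℝ)..t, q (θ * Y r ω + (1 - θ) * X r ω) ∂ℙ ≤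
      1 + occupationConst C t * V ^ 2 := by
  have := hw.isProb
  set Z : ℝ → Ω → ℝ := fun θ ω => ∫ r in (0 : ℝ)..t, q (θ * Y r ω + (1 - θ) * X r ω)
  have hQl : ∀ a b, |Q a - Q b| ≤ K * |a - b| := fun a b => abs_sub_le_of_hasDerivAt hQ hK b a
  have hZi : ∀ {θ}, θ ∈ Icc (0 : ℝ) 1 → ∀ k : ℕ, Integrable (fun ω => Z θ ω ^ k) ℙ := fun hθ k =>
    (hX.convexCombo hY hθ).integrable_integral_pow hw hq.measurable hK ht k
  have hZ : ∀ {θ}, θ ∈ Icc (0 : ℝ) 1 → ∫ ω, Z θ ω ∂ℙ ≤ 1 + occupationConst C t * V ^ 2 := by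
    intro θ hθ
    have h1 := (hX.convexCombo hY hθ).integral_sq_integral_le_sq hw
      (fun z => (hQ z).hasDerivWithinAt) hV hQl ht
    calc ∫ ω, Z θ ω ∂ℙ ≤ ∫ ω, (1 + Z θ ω ^ 2) ∂ℙ := by
          refine integral_mono (by simpa using hZi hθ 1)
            ((integrable_const 1).add (hZi hθ 2)) fun ω => ?_
          show Z θ ω ≤ 1 + Z θ ω ^ 2
          nlinarith [sq_nonneg (Z θ ω - 1 / 2)]
      _ = 1 + ∫ ω, Z θ ω ^ 2 ∂ℙ := by
          rw [integral_add (integrable_const 1) (hZi hθ 2)]; simp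
      _ ≤ _ := by gcongr; exact h1
  have hmem : ∀ {m i : ℕ}, i ∈ Finset.range (m + 1) →
      (i : ℝ) * (1 / ((m : ℝ) + 1)) ∈ Icc (0 : ℝ) 1 := by
    intro m i hi
    refine ⟨by positivity, ?_⟩
    rw [mul_one_div, div_le_one (by positivity)]
    exact_mod_cast (Finset.mem_range.1 hi).le
  refine integral_le_of_tendsto_ae (F := fun (m : ℕ) ω => ∑ i ∈ Finset.range (m + 1),
    Z (i * (1 / ((m : ℝ) + 1))) ω * (1 / ((m : ℝ) + 1))) (fun m => ?_) (fun m ω => ?_)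
    (Eventually.of_forall fun m => ?_) ?_
  · refine integrable_finsetSum _ fun i hi => ?_
    exact (by simpa using hZi (hmem hi) 1 : Integrable (Z _) ℙ).mul_const _
  · refine Finset.sum_nonneg fun i _ => mul_nonneg ?_ (by positivity)
    exact intervalIntegral.integral_nonneg ht fun r _ => hq0 _
  · rw [integral_finsetSum _ fun i hi =>
      (by simpa using hZi (hmem hi) 1 : Integrable (Z _) ℙ).mul_const _]
    calc _ ≤ ∑ i ∈ Finset.range (m + 1),
          (1 + occupationConst C t * V ^ 2) * (1 / ((m : ℝ) + 1)) := by
          refine Finset.sum_le_sum fun i hi => ?_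
          rw [integral_mul_const]
          exact mul_le_mul_of_nonneg_right (hZ (hmem hi)) (by positivity)
      _ = _ := by
          rw [Finset.sum_const, Finset.card_range, nsmul_eq_mul]
          push_cast
          field_simp
  · filter_upwards [hX.ae_continuousOn hw, hY.ae_continuousOn hw] with ω hωX hωY
    refine tendsto_riemann_sum zero_le_one (Continuous.continuousOn ?_)
    have hXc' : Continuous fun s => X (max s 0) ω :=
      hωX.comp_continuous (by fun_prop) fun s => le_max_right s 0
    have hYc' : Continuous fun s => Y (max s 0) ω :=
      hωY.comp_continuous (by fun_prop) fun s => le_max_right s 0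
    have hFc : Continuous (Function.uncurry fun (θ s : ℝ) =>
        q (θ * Y (max s 0) ω + (1 - θ) * X (max s 0) ω)) :=
      hq.comp ((continuous_fst.mul (hYc'.comp continuous_snd)).add
        ((continuous_const.sub continuous_fst).mul (hXc'.comp continuous_snd)))
    refine (intervalIntegral.continuous_parametric_intervalIntegral_of_continuous' hFc 0 t).congr
      fun θ => intervalIntegral.integral_congr fun r hr => ?_
    rw [uIcc_of_le ht] at hr
    simp only [max_eq_left hr.1]

end Drift

section Convergence

variable {Ω : Type*} [MeasureSpace Ω] {w : ℝ → Ω → ℝ} {C x : ℝ} {X Y : ℝ → Ω → ℝ}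

theorem IsMollifier.continuous_mollify {g : ℕ → ℝ → ℝ} (hg : IsMollifier g) {n : ℕ} (hn : 1 ≤ n)
    {u : ℝ → ℝ} {V : ℝ} (hu : Measurable u) (hV : ∀ z, |u z| ≤ V) : Continuous (mollify g u n) := by
  obtain ⟨u', K, -, -, h⟩ := hg.exists_hasDerivAt_mollify hn hu hV
  exact continuous_iff_continuousAt.2 fun z => (h z).continuousAt

theorem IsDrifted.tendsto_integral_abs_mollify_sub (hX : IsDrifted w C x X) (hw : IsWiener w)
    {g : ℕ → ℝ → ℝ} (hg : IsMollifier g) {u : ℝ → ℝ} {V : ℝ} (hu : Measurable u)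
    (hV : ∀ z, |u z| ≤ V) (hc : {z | ¬ ContinuousAt u z}.Countable) {t : ℝ} (ht : 0 ≤ t) :
    Tendsto (fun n => ∫ ω, ∫ r in (0 : ℝ)..t, |mollify g u n (X r ω) - u (X r ω)| ∂ℙ) atTop
      (nhds 0) := by
  have := hw.isProb
  have hm : ∀ n, 1 ≤ n → Measurable fun z => |mollify g u n z - u z| := fun n hn =>
    ((hg.continuous_mollify hn hu hV).measurable.sub hu).abs
  have hb : ∀ n, 1 ≤ n → ∀ z, ‖|mollify g u n z - u z|‖ ≤ 2 * V := fun n hn z => by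
    rw [Real.norm_eq_abs, abs_abs]
    linarith [abs_sub (mollify g u n z) (u z), hV z, hg.abs_mollify_le hn hu hV z]
  rw [show nhds (0 : ℝ) = nhds (∫ _ : Ω, (0 : ℝ) ∂ℙ) by simp]
  refine tendsto_integral_filter_of_dominated_convergence (fun _ => 2 * V * t) ?_ ?_
    (integrable_const _) ?_
  · filter_upwards [eventually_ge_atTop 1] with n hn
    exact hX.aestronglyMeasurable_integral hw (hm n hn) ht
  · filter_upwards [eventually_ge_atTop 1] with n hn
    exact ae_of_all _ fun ω =>
      abs_integral_comp_path_le (u := fun z => |mollify g u n z - u z|) (hb n hn) ht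
  · have hne : ∀ᵐ ω ∂(ℙ : Measure Ω), ∀ a ∈ {z | ¬ ContinuousAt u z},
        ∀ᵐ s ∂(volume.restrict (Ioc 0 t)), X s ω ≠ a :=
      (ae_ball_iff hc).2 fun a _ => hX.ae_ae_ne hw ht a
    filter_upwards [hne, hX.ae_continuousOn hw] with ω hω hcω
    rw [show nhds (0 : ℝ) = nhds (∫ _ in (0 : ℝ)..t, (0 : ℝ)) by simp]
    refine intervalIntegral.tendsto_integral_filter_of_dominated_convergence (fun _ => 2 * V)
      ?_ ?_ intervalIntegrable_const ?_
    · filter_upwards [eventually_ge_atTop 1] with n hn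
      exact aestronglyMeasurable_comp_path hcω (hm n hn) ht
    · filter_upwards [eventually_ge_atTop 1] with n hn
      exact ae_of_all _ fun s _ => hb n hn _
    · have h1 := (ae_restrict_iff' measurableSet_Ioc).1 ((ae_ball_iff hc).2 hω)
      filter_upwards [h1] with s hs hst
      rw [uIoc_of_le ht] at hst
      have h2 : ContinuousAt u (X s ω) := by
        by_contra h
        exact hs hst _ h rfl
      have h3 := ((hg.tendsto_mollify hu hV h2).sub_const (u (X s ω))).abs
      simpa using h3

theorem integrable_sq_sub_bump (hX : IsDrifted w C x X) (hY : IsDrifted w C x Y) (hw : IsWiener w)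
    {y δ B : ℝ} {G k : ℝ → ℝ} (hk : IsBump y δ G k B) {t : ℝ} (ht : 0 ≤ t) :
    Integrable (fun ω => ((∫ r in (0 : ℝ)..t, k (Y r ω)) - ∫ r in (0 : ℝ)..t, k (X r ω)) ^ 2)
      ℙ := by
  have := hw.isProb
  have hm := hk.continuous.measurable
  refine Integrable.of_bound (((hY.aestronglyMeasurable_integral hw hm ht).sub
    (hX.aestronglyMeasurable_integral hw hm ht)).pow 2) ((B * t + B * t) ^ 2)
    (ae_of_all _ fun ω => ?_)
  rw [Real.norm_eq_abs, abs_pow]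
  exact pow_le_pow_left₀ (abs_nonneg _) ((abs_sub _ _).trans
    (add_le_add (abs_integral_comp_path_le hk.bound ht) (abs_integral_comp_path_le hk.bound ht))) 2

theorem integral_sq_sub_bump_le {u v Q q : ℝ → ℝ} {V K : ℝ} (hw : IsWiener w)
    (hX : IsStrongSolution u w x X) (hY : IsStrongSolution v w x Y)
    (hu : Measurable u) (hv : Measurable v) (huV : ∀ z, |u z| ≤ V) (hvV : ∀ z, |v z| ≤ V)
    (hQ : ∀ z, HasDerivAt Q (q z) z) (hq : Continuous q) (hq0 : ∀ z, 0 ≤ q z)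
    (hK : ∀ z, |q z| ≤ K) (hQV : ∀ z, |Q z| ≤ V) (hvQ : ∀ a b, |v a - v b| ≤ |Q a - Q b|)
    {y δ B : ℝ} {G k : ℝ → ℝ} (hk : IsBump y δ G k B) {t : ℝ} (ht : 0 ≤ t) {a : ℝ} (ha : 0 < a) :
    ∫ ω, ((∫ r in (0 : ℝ)..t, k (Y r ω)) - ∫ r in (0 : ℝ)..t, k (X r ω)) ^ 2 ∂ℙ ≤
      4 * (B * t) ^ 2 * (Real.exp a * (∫ ω, ∫ r in (0 : ℝ)..t, |v (X r ω) - u (X r ω)| ∂ℙ) +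
        a⁻¹ * (1 + occupationConst V t * V ^ 2)) := by
  have := hw.isProb
  have hXd := hX.isDrifted hu huV
  have hYd := hY.isDrifted hv hvV
  obtain ⟨hJi, hJ⟩ := hXd.integral_segment_le hYd hw hQ hq hq0 hK hQV ht
  set J : Ω → ℝ := fun ω => ∫ θ in (0 : ℝ)..1, ∫ r in (0 : ℝ)..t,
    q (θ * Y r ω + (1 - θ) * X r ω)
  have hvu : ∀ z, |(|v z - u z|)| ≤ V + V := fun z => by
    rw [abs_abs]
    exact (abs_sub _ _).trans (add_le_add (hvV z) (huV z))
  have hRi := hXd.integrable_integral_pow hw (u := fun z => |v z - u z|) (hv.sub hu).abs hvu ht 1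
  simp only [pow_one] at hRi
  set R : Ω → ℝ := fun ω => ∫ r in (0 : ℝ)..t, |v (X r ω) - u (X r ω)|
  have hB0 : 0 ≤ B := (abs_nonneg _).trans (hk.bound 0)
  have hR0 : ∀ ω, 0 ≤ R ω := fun ω => intervalIntegral.integral_nonneg ht fun r _ => abs_nonneg _
  have hJ0 : ∀ ω, 0 ≤ J ω := fun ω => intervalIntegral.integral_nonneg zero_le_one fun θ _ =>
    intervalIntegral.integral_nonneg ht fun r _ => hq0 _
  have hBt : 0 ≤ B * t := mul_nonneg hB0 ht
  calc _ ≤ ∫ ω, 4 * (B * t) ^ 2 * (Real.exp a * R ω + a⁻¹ * J ω) ∂ℙ := by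
        refine integral_mono_ae (integrable_sq_sub_bump hXd hYd hw hk ht)
          (((hRi.const_mul _).add (hJi.const_mul _)).const_mul _) ?_
        filter_upwards [hX.cont, hX.sde, hY.cont, hY.sde] with ω hXc hXs hYc hYs
        have hstab : ∀ s ∈ Icc 0 t, |Y s ω - X s ω| ≤ R ω * Real.exp (J ω) := fun s hs =>
          abs_sub_le_of_dominated hXc hYc hu hv huV hvV hXs hYs hQ hq hq0 hvQ hs
        set S := (∫ r in (0 : ℝ)..t, k (Y r ω)) - ∫ r in (0 : ℝ)..t, k (X r ω) with hS
        have hS1 : |S| ≤ 2 * (B * t) := by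
          refine (abs_sub _ _).trans ?_
          rw [two_mul]
          exact add_le_add (abs_integral_comp_path_le hk.bound ht)
            (abs_integral_comp_path_le hk.bound ht)
        have hS2 : |S| ≤ B * t * (R ω * Real.exp (J ω)) := by
          have hkm := hk.continuous.measurable
          rw [hS, ← intervalIntegral.integral_sub
            (intervalIntegrable_comp_path hYc hkm hk.bound ht)
            (intervalIntegrable_comp_path hXc hkm hk.bound ht)]
          have := intervalIntegral.norm_integral_le_of_norm_le_const (a := 0) (b := t)
            (f := fun r => k (Y r ω) - k (X r ω)) (C := B * (R ω * Real.exp (J ω)))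
            fun r hr => by
              rw [uIoc_of_le ht] at hr
              exact (hk.lip _ _).trans
                (mul_le_mul_of_nonneg_left (hstab r ⟨hr.1.le, hr.2⟩) hB0)
          rw [sub_zero, abs_of_nonneg ht, Real.norm_eq_abs] at this
          linarith
        show S ^ 2 ≤ 4 * (B * t) ^ 2 * (Real.exp a * R ω + a⁻¹ * J ω)
        have hR := hR0 ω
        have hJω := hJ0 ω
        have hea := Real.exp_pos a
        rw [← sq_abs]
        rcases le_total (J ω) a with h | h
        · have h1 : R ω * Real.exp (J ω) ≤ R ω * Real.exp a :=
            mul_le_mul_of_nonneg_left (Real.exp_le_exp.2 h) hR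
          calc |S| ^ 2 = |S| * |S| := sq _
            _ ≤ (2 * (B * t)) * (B * t * (R ω * Real.exp a)) :=
              mul_le_mul hS1 (hS2.trans (mul_le_mul_of_nonneg_left h1 hBt)) (abs_nonneg _)
                (by positivity)
            _ = 2 * (B * t) ^ 2 * (Real.exp a * R ω) := by ring
            _ ≤ 4 * (B * t) ^ 2 * (Real.exp a * R ω + a⁻¹ * J ω) := by
              refine mul_le_mul ?_ (le_add_of_nonneg_right (by positivity)) (by positivity)
                (by positivity)
              nlinarith [sq_nonneg (B * t)]
        · have h1 : 1 ≤ a⁻¹ * J ω := by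
            rw [inv_mul_eq_div, one_le_div ha]; exact h
          calc |S| ^ 2 ≤ (2 * (B * t)) ^ 2 := pow_le_pow_left₀ (abs_nonneg _) hS1 2
            _ = 4 * (B * t) ^ 2 * 1 := by ring
            _ ≤ _ := mul_le_mul_of_nonneg_left
              (h1.trans (le_add_of_nonneg_left (by positivity))) (by positivity)
    _ = 4 * (B * t) ^ 2 * (Real.exp a * (∫ ω, R ω ∂ℙ) + a⁻¹ * ∫ ω, J ω ∂ℙ) := by
        rw [integral_const_mul, integral_add (hRi.const_mul _) (hJi.const_mul _),
          integral_const_mul, integral_const_mul]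
    _ ≤ _ := by gcongr

/-- Stability of smooth additive functionals under mollification of the drift. -/
theorem eventually_integral_sq_sub_bump_le {α : ℝ → ℝ} {g : ℕ → ℝ → ℝ} {Yn : ℕ → ℝ → Ω → ℝ}
    (hw : IsWiener w) (hC : CondC α) (hg : IsMollifier g) (hX : IsStrongSolution α w x X)
    (hY : ∀ n, 1 ≤ n → IsStrongSolution (mollify g α n) w x (Yn n))
    {y δ B : ℝ} {G k : ℝ → ℝ} (hk : IsBump y δ G k B) {t : ℝ} (ht : 0 ≤ t) {η : ℝ} (hη : 0 < η) :
    ∀ᶠ n in atTop,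
      ∫ ω, ((∫ r in (0 : ℝ)..t, k (Yn n r ω)) - ∫ r in (0 : ℝ)..t, k (X r ω)) ^ 2 ∂ℙ ≤ η := by
  obtain ⟨hα, P, V, hP, hPV, hαV, hdom⟩ := hC.exists_monotone_dominating
  have hcount : {z | ¬ ContinuousAt α z}.Countable := by
    refine hP.countable_not_continuousAt.mono fun z (hz : ¬ ContinuousAt α z) =>
      show ¬ ContinuousAt P z from fun hPz => hz ?_
    rw [ContinuousAt, tendsto_iff_dist_tendsto_zero] at hPz ⊢
    exact squeeze_zero (fun _ => dist_nonneg) (fun u => hdom u z) hPz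
  have hR := (hX.isDrifted hα hαV).tendsto_integral_abs_mollify_sub hw hg hα hαV hcount ht
  have hc0 : 0 ≤ 1 + occupationConst V t * V ^ 2 :=
    add_nonneg zero_le_one (mul_nonneg (occupationConst_nonneg ht) (sq_nonneg V))
  set c := 4 * (B * t) ^ 2 * (1 + occupationConst V t * V ^ 2) with hc
  have hcn : 0 ≤ c := by positivity
  set a := 2 * c / η + 1 with ha
  have ha0 : 0 < a := by positivity
  have hR' := hR.const_mul (4 * (B * t) ^ 2 * Real.exp a)
  rw [mul_zero] at hR'
  filter_upwards [eventually_ge_atTop 1, hR'.eventually (Iic_mem_nhds (half_pos hη))] with n hn hn2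
  obtain ⟨q, K, hq, hK, hQ⟩ := hg.exists_hasDerivAt_mollify hn hP.measurable hPV
  have hQm := hg.monotone_mollify hn hP hPV
  have hq0 : ∀ z, 0 ≤ q z := fun z => by
    rw [← (hQ z).deriv]; exact hQm.deriv_nonneg
  have h := integral_sq_sub_bump_le hw hX (hY n hn) hα
    (hg.continuous_mollify hn hα hαV).measurable hαV (hg.abs_mollify_le hn hα hαV) hQ hq hq0 hK
    (hg.abs_mollify_le hn hP.measurable hPV)
    (hg.abs_mollify_sub_mollify_le hn hP hα hαV hPV hdom) hk ht ha0
  refine h.trans ?_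
  have h1 : a⁻¹ * c ≤ η / 2 := by
    rw [inv_mul_le_iff₀ ha0, ha]
    have : (2 * c / η + 1) * (η / 2) = c + η / 2 := by field_simp
    rw [this]
    linarith
  have h2 : _ ≤ η / 2 := hn2
  calc _ = 4 * (B * t) ^ 2 * Real.exp a *
        (∫ ω, ∫ r in (0 : ℝ)..t, |mollify g α n (X r ω) - α (X r ω)| ∂ℙ) + a⁻¹ * c := by
        rw [hc]; ring
    _ ≤ η := by linarith

end Convergence

/-- Let `α` have bounded variation on `ℝ` and compact support, let `φ`
solve the SDE with drift `α` and `φⁿ` the SDE with the mollified drift `αₙ`, and let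
`L_y^{φ(x)}(t)`, `L_y^{φⁿ(x)}(t)` be the corresponding local times. Then for all `t ≥ 0`
and `x, y ∈ ℝ`, `E|L_y^{φⁿ(x)}(t) - L_y^{φ(x)}(t)|² → 0` as `n → ∞`. -/
theorem local_time_L2_convergence
    {Ω : Type*} [MeasureSpace Ω] (w : ℝ → Ω → ℝ) (hw : IsWiener w)
    (α : ℝ → ℝ) (hC : CondC α) (hsupp : HasCompactSupport α)
    (g : ℕ → ℝ → ℝ) (hg : IsMollifier g)
    (φ : ℝ → ℝ → Ω → ℝ) (hφ : ∀ x : ℝ, IsStrongSolution α w x (fun s => φ s x))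
    (φn : ℕ → ℝ → ℝ → Ω → ℝ)
    (hφn : ∀ n : ℕ, 1 ≤ n → ∀ x : ℝ, IsStrongSolution (mollify g α n) w x (fun s => φn n s x))
    -- the local times `L y t x ω` of `φ(x)` and `Ln n y t x ω` of `φⁿ(x)` at level `y` up to time `t`
    (L : ℝ → ℝ → ℝ → Ω → ℝ) (Ln : ℕ → ℝ → ℝ → ℝ → Ω → ℝ)
    (hL : ∀ y t x : ℝ, 0 ≤ t →
      ∀ᵐ ω ∂(ℙ : Measure Ω), IsLocalTime (fun s => φ s x ω) y t (L y t x ω))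
    (hLn : ∀ n : ℕ, 1 ≤ n → ∀ y t x : ℝ, 0 ≤ t →
      ∀ᵐ ω ∂(ℙ : Measure Ω), IsLocalTime (fun s => φn n s x ω) y t (Ln n y t x ω))
    (t : ℝ) (ht : 0 ≤ t) (x y : ℝ) :
    Filter.Tendsto (fun n : ℕ => ∫ ω, |Ln n y t x ω - L y t x ω| ^ 2 ∂(ℙ : Measure Ω))
      Filter.atTop (nhds 0) := by
  obtain ⟨hα, P, V, hP, hPV, hαV, hdom⟩ := hC.exists_monotone_dominating
  have hXd := (hφ x).isDrifted hα hαV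
  rw [Metric.tendsto_atTop']
  intro ε hε
  set K := localTimeConst V t
  have hK : 0 ≤ K := localTimeConst_nonneg ht
  obtain ⟨δ, hδ, hδε⟩ : ∃ δ : ℝ, 0 < δ ∧ 16 * (4 * δ ^ 2 + K * δ) ≤ ε / 10 := by
    have h1 : Tendsto (fun δ : ℝ => 16 * (4 * δ ^ 2 + K * δ)) (nhdsWithin 0 (Ioi 0)) (nhds 0) := by
      have h2 : Continuous fun δ : ℝ => 16 * (4 * δ ^ 2 + K * δ) := by fun_prop
      simpa using (h2.tendsto 0).mono_left nhdsWithin_le_nhds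
    obtain ⟨δ, h, h0⟩ := ((h1.eventually (Iic_mem_nhds (show (0 : ℝ) < ε / 10 by positivity))).and
      self_mem_nhdsWithin).exists
    exact ⟨δ, h0, h⟩
  obtain ⟨G, k, B, hk⟩ := exists_isBump y hδ
  obtain ⟨N, hN⟩ := eventually_atTop.1 (eventually_integral_sq_sub_bump_le hw hC hg (hφ x)
    (fun n hn => hφn n hn x) hk ht (show 0 < ε / 10 by positivity))
  refine ⟨max N 1, fun n hn => ?_⟩
  have hn1 : 1 ≤ n := (le_max_right N 1).trans hn.le
  have hS := hN n ((le_max_left N 1).trans hn.le)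
  have hYd := (hφn n hn1 x).isDrifted (hg.continuous_mollify hn1 hα hαV).measurable
    (hg.abs_mollify_le hn1 hα hαV)
  obtain ⟨hi1, h1⟩ := hXd.integral_sq_localTime_sub_bump_le hw ht hδ hk (hL y t x ht)
  obtain ⟨hi2, h2⟩ := hYd.integral_sq_localTime_sub_bump_le hw ht hδ hk (hLn n hn1 y t x ht)
  have hi3 := integrable_sq_sub_bump hXd hYd hw hk ht
  rw [Real.dist_eq, sub_zero, abs_of_nonneg (integral_nonneg fun ω => by positivity)]
  calc _ ≤ ∫ ω, (3 * (L y t x ω - ∫ s in (0 : ℝ)..t, k (φ s x ω)) ^ 2 +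
        3 * (Ln n y t x ω - ∫ s in (0 : ℝ)..t, k (φn n s x ω)) ^ 2 +
        3 * ((∫ s in (0 : ℝ)..t, k (φn n s x ω)) - ∫ s in (0 : ℝ)..t, k (φ s x ω)) ^ 2) ∂ℙ := by
        refine integral_mono_of_nonneg (ae_of_all _ fun ω => by positivity)
          (((hi1.const_mul 3).add (hi2.const_mul 3)).add (hi3.const_mul 3))
          (ae_of_all _ fun ω => ?_)
        set a := L y t x ω - ∫ s in (0 : ℝ)..t, k (φ s x ω) with ha
        set b := Ln n y t x ω - ∫ s in (0 : ℝ)..t, k (φn n s x ω) with hb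
        set c := (∫ s in (0 : ℝ)..t, k (φn n s x ω)) - ∫ s in (0 : ℝ)..t, k (φ s x ω) with hc
        have e : Ln n y t x ω - L y t x ω = b + c - a := by rw [ha, hb, hc]; ring
        show |Ln n y t x ω - L y t x ω| ^ 2 ≤ 3 * a ^ 2 + 3 * b ^ 2 + 3 * c ^ 2
        rw [sq_abs, e]
        nlinarith [sq_nonneg (b - c), sq_nonneg (b + a), sq_nonneg (c + a)]
    _ ≤ 3 * (ε / 10) + 3 * (ε / 10) + 3 * (ε / 10) := by
        have hi12 : Integrable (fun ω => 3 * (L y t x ω - ∫ s in (0 : ℝ)..t, k (φ s x ω)) ^ 2 +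
            3 * (Ln n y t x ω - ∫ s in (0 : ℝ)..t, k (φn n s x ω)) ^ 2) ℙ :=
          (hi1.const_mul 3).add (hi2.const_mul 3)
        rw [integral_add hi12 (hi3.const_mul 3),
          integral_add (hi1.const_mul 3) (hi2.const_mul 3), integral_const_mul,
          integral_const_mul, integral_const_mul]
        linarith
    _ < ε := by linarith

end
end

section
/- Let {ξₙ : n ≥ 0} be a sequence of real random variables such that for each n ≥ 1 the distribution of ξₙ is absolutely continuous with respect to a probability measure ν on ℝ, with density qₙ. Let {fₙ : n ≥ 0} be a sequence of measurable real functions. Suppose: (1) ξₙ → ξ₀ in probability as n → ∞; (2) fₙ → f₀ in ν-measure as n → ∞; (3) the sequence of densities {qₙ : n ≥ 1} is uniformly integrable with respect to ν. Then fₙ(ξₙ) → f₀(ξ₀) in probability as n → ∞. -/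
open MeasureTheory ProbabilityTheory Filter Set

noncomputable section

open scoped ENNReal

/-- A measurable real function is approximated in measure by continuous functions. -/
theorem exists_continuous_measure_le_dist_le {X : Type*} [TopologicalSpace X] [NormalSpace X]
    [MeasurableSpace X] [BorelSpace X] (ν : Measure X) [IsFiniteMeasure ν] [ν.WeaklyRegular]
    {f : X → ℝ} (hf : Measurable f) {ε : ℝ} (hε : 0 < ε) {δ : ℝ≥0∞} (hδ : 0 < δ) :
    ∃ g : X → ℝ, Continuous g ∧ ν {x | ε ≤ dist (f x) (g x)} ≤ δ := by
  let F : ℕ → X → ℝ := fun k => {x | |f x| ≤ k}.indicator f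
  have hFm (k : ℕ) : Measurable (F k) :=
    hf.indicator (measurableSet_le hf.abs measurable_const)
  have hFlim : TendstoInMeasure ν F atTop f := by
    refine tendstoInMeasure_of_tendsto_ae (fun k => (hFm k).aestronglyMeasurable)
      (Eventually.of_forall fun x => tendsto_const_nhds.congr' ?_)
    filter_upwards [eventually_ge_atTop ⌈|f x|⌉₊] with k hk
    exact (indicator_of_mem (s := {x | |f x| ≤ k}) (Nat.ceil_le.1 hk) f).symm
  have hδ2 : 0 < δ / 2 := ENNReal.half_pos hδ.ne'
  obtain ⟨k, hk⟩ := ((tendstoInMeasure_iff_dist.1 hFlim (ε / 2) (by positivity)).eventually_le_const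
    hδ2).exists
  have hFk : MemLp (F k) 1 ν := by
    refine MemLp.of_bound (hFm k).aestronglyMeasurable k (Eventually.of_forall fun x => ?_)
    by_cases hx : |f x| ≤ k <;> simp [F, hx]
  have hc : ENNReal.ofReal (ε / 2) ≠ 0 := by simpa using hε
  obtain ⟨g, hg, -⟩ := hFk.exists_boundedContinuous_eLpNorm_sub_le ENNReal.one_ne_top
    (mul_ne_zero hc hδ2.ne')
  refine ⟨g, g.continuous, ?_⟩
  have hmarkov : ν {x | ε / 2 ≤ dist (F k x) (g x)} ≤ δ / 2 := by
    have h := meas_ge_le_lintegral_div (μ := ν) (f := fun x => ‖F k x - g x‖ₑ)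
      (((hFm k).sub g.continuous.measurable).enorm.aemeasurable) hc ENNReal.ofReal_ne_top
    rw [eLpNorm_one_eq_lintegral_enorm] at hg
    refine (measure_mono fun x hx => ?_).trans (h.trans (ENNReal.div_le_of_le_mul' hg))
    simp only [mem_ofPred_eq] at hx ⊢
    rw [← edist_eq_enorm_sub, edist_dist]
    exact ENNReal.ofReal_le_ofReal hx
  calc ν {x | ε ≤ dist (f x) (g x)}
      ≤ ν ({x | ε / 2 ≤ dist (F k x) (f x)} ∪ {x | ε / 2 ≤ dist (F k x) (g x)}) := by
        refine measure_mono fun x hx => ?_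
        by_contra! h
        simp only [mem_union, mem_ofPred_eq, not_or, not_le] at h hx
        linarith [dist_triangle_left (f x) (g x) (F k x)]
    _ ≤ δ / 2 + δ / 2 := (measure_union_le _ _).trans (add_le_add hk hmarkov)
    _ = δ := ENNReal.add_halves δ

/-- Measures whose densities have uniformly small tails are uniformly absolutely continuous. -/
theorem exists_forall_withDensity_le_of_tail_integral_lt {ι X : Type*} [MeasurableSpace X]
    (ν : Measure X) {q : ι → X → ℝ} (hqmeas : ∀ i, Measurable (q i)) (hq : ∀ i x, 0 ≤ q i x)
    (hint : ∀ i, Integrable (q i) ν)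
    (htail : ∀ ε > (0 : ℝ), ∃ K : ℝ, ∀ i, (∫ x in {x | K < q i x}, q i x ∂ν) < ε)
    {ε : ℝ≥0∞} (hε : 0 < ε) :
    ∃ δ : ℝ≥0∞, 0 < δ ∧ ∀ i A, MeasurableSet A → ν A < δ →
      ν.withDensity (fun x => ENNReal.ofReal (q i x)) A ≤ ε := by
  have hε2 : 0 < ε / 2 := ENNReal.half_pos hε.ne'
  obtain ⟨r, hr0, hr⟩ := ENNReal.lt_iff_exists_real_btwn.1 hε2
  have hr0' : 0 < r := by simpa using hr.1
  obtain ⟨K, hK⟩ := htail r hr0'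
  refine ⟨ε / 2 / ENNReal.ofReal K, ENNReal.div_pos hε2.ne' ENNReal.ofReal_ne_top,
    fun i A hA hνA => ?_⟩
  have htail_le : ∫⁻ x in {x | K < q i x}, ENNReal.ofReal (q i x) ∂ν ≤ ε / 2 := by
    rw [← ofReal_integral_eq_lintegral_ofReal (hint i).integrableOn
      (Eventually.of_forall (hq i))]
    exact (ENNReal.ofReal_le_ofReal (hK i).le).trans hr.2.le
  have hT : MeasurableSet {x | K < q i x} := measurableSet_lt measurable_const (hqmeas i)
  rw [withDensity_apply _ hA]
  calc ∫⁻ x in A, ENNReal.ofReal (q i x) ∂ν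
      = ∫⁻ x in A ∩ {x | K < q i x}, ENNReal.ofReal (q i x) ∂ν
        + ∫⁻ x in A \ {x | K < q i x}, ENNReal.ofReal (q i x) ∂ν :=
        (lintegral_inter_add_sdiff _ A hT).symm
    _ ≤ ∫⁻ x in {x | K < q i x}, ENNReal.ofReal (q i x) ∂ν
        + ∫⁻ _ in A \ {x | K < q i x}, ENNReal.ofReal K ∂ν := by
        refine add_le_add (lintegral_mono_set inter_subset_right)
          (setLIntegral_mono measurable_const fun x hx => ENNReal.ofReal_le_ofReal ?_)
        exact not_lt.1 hx.2
    _ ≤ ε / 2 + ε / 2 := by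
        refine add_le_add htail_le ?_
        rw [setLIntegral_const]
        calc ENNReal.ofReal K * ν (A \ {x | K < q i x})
            ≤ ENNReal.ofReal K * (ε / 2 / ENNReal.ofReal K) := by
              gcongr
              exact (measure_mono sdiff_subset).trans hνA.le
          _ ≤ ε / 2 := ENNReal.mul_div_le
    _ = ε := ENNReal.add_halves ε

/-- A bound on the laws of a sequence over the sets of small `ν`-measure passes to the law of the
limit in probability. -/
theorem measure_preimage_le_of_tendstoInMeasure {Ω X : Type*} [MeasurableSpace Ω]
    {P : Measure Ω} [IsProbabilityMeasure P] [PseudoEMetricSpace X]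
    [MeasurableSpace X] [BorelSpace X] {ν : Measure X} [ν.OuterRegular]
    {ξ : ℕ → Ω → X} {ξ₀ : Ω → X} (hξ : ∀ n, Measurable (ξ n)) (hξ₀ : Measurable ξ₀)
    (hlim : TendstoInMeasure P ξ atTop ξ₀) {ε δ : ℝ≥0∞}
    (hbound : ∀ᶠ n in atTop, ∀ A, MeasurableSet A → ν A < δ → P (ξ n ⁻¹' A) ≤ ε)
    {A : Set X} (hA : ν A < δ) :
    P (ξ₀ ⁻¹' A) ≤ ε := by
  obtain ⟨U, hAU, hU, hνU⟩ := A.exists_isOpen_lt_of_lt δ hA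
  have hdist := (hlim.tendstoInDistribution fun n => (hξ n).aemeasurable).tendsto
  have h := ProbabilityMeasure.le_liminf_measure_open_of_tendsto hdist hU
  simp only [ProbabilityMeasure.coe_mk, Measure.map_apply hξ₀ hU.measurableSet,
    Measure.map_apply (hξ _) hU.measurableSet] at h
  refine (measure_mono (preimage_mono hAU)).trans (h.trans ?_)
  refine (liminf_le_liminf (hbound.mono fun n hn => hn U hU.measurableSet hνU)).trans ?_
  simp

/-- The continuous mapping theorem for convergence in measure. -/
theorem MeasureTheory.TendstoInMeasure.continuous_comp {Ω X Y : Type*} [MeasurableSpace Ω]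
    {P : Measure Ω} [IsFiniteMeasure P] [PseudoEMetricSpace X] [PseudoEMetricSpace Y]
    {ξ : ℕ → Ω → X} {ξ₀ : Ω → X} (hξ : ∀ n, AEStronglyMeasurable (ξ n) P)
    (hlim : TendstoInMeasure P ξ atTop ξ₀) {g : X → Y} (hg : Continuous g) :
    TendstoInMeasure P (fun n ω => g (ξ n ω)) atTop (fun ω => g (ξ₀ ω)) := by
  refine (exists_seq_tendstoInMeasure_atTop_iff
    fun n => hg.comp_aestronglyMeasurable (hξ n)).2 fun ns hns => ?_
  obtain ⟨ns', hns', h⟩ := (exists_seq_tendstoInMeasure_atTop_iff hξ).1 hlim ns hns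
  refine ⟨ns', hns', h.mono fun ω hω => (hg.tendsto _).comp hω⟩

/-- Let `ξₙ` be random variables whose distributions (for `n ≥ 1`) are
absolutely continuous w.r.t. a probability measure `ν` on `ℝ` with densities `qₙ`, and let
`fₙ` be measurable functions. If (1) `ξₙ → ξ₀` in probability, (2) `fₙ → f₀` in
`ν`-measure, and (3) the densities `{qₙ : n ≥ 1}` are uniformly integrable w.r.t. `ν`
(i.e. `sup_{n≥1} ∫_{qₙ>K} qₙ dν → 0` as `K → ∞`), then `fₙ(ξₙ) → f₀(ξ₀)` in
probability. -/
theorem composition_convergence_in_probability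
    {Ω : Type*} [MeasureSpace Ω] [IsProbabilityMeasure (ℙ : Measure Ω)]
    (ξ : ℕ → Ω → ℝ) (hξmeas : ∀ n, Measurable (ξ n))
    (ν : Measure ℝ) [IsProbabilityMeasure ν]
    (q : ℕ → ℝ → ℝ) (hqmeas : ∀ n, Measurable (q n)) (hqnonneg : ∀ n x, 0 ≤ q n x)
    (hdens : ∀ n : ℕ, 1 ≤ n →
      Measure.map (ξ n) ℙ = ν.withDensity (fun x => ENNReal.ofReal (q n x)))
    (f : ℕ → ℝ → ℝ) (hfmeas : ∀ n, Measurable (f n))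
    (h1 : TendstoInMeasure (ℙ : Measure Ω) (fun n => ξ n) Filter.atTop (ξ 0))
    (h2 : TendstoInMeasure ν (fun n => f n) Filter.atTop (f 0))
    (h3 : ∀ ε > (0:ℝ), ∃ K : ℝ, ∀ n : ℕ, 1 ≤ n →
      (∫ x in {x | K < q n x}, q n x ∂ν) < ε) :
    TendstoInMeasure (ℙ : Measure Ω) (fun n ω => f n (ξ n ω)) Filter.atTop
      (fun ω => f 0 (ξ 0 ω)) := by
  have hint (n : Ici 1) : Integrable (q n) ν := by
    refine ⟨(hqmeas n).aestronglyMeasurable, ?_⟩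
    rw [hasFiniteIntegral_iff_ofReal (Eventually.of_forall (hqnonneg n)),
      ← setLIntegral_univ, ← withDensity_apply _ MeasurableSet.univ, ← hdens n n.2]
    exact (Measure.map_apply (hξmeas n) MeasurableSet.univ).trans_lt (measure_lt_top _ _)
  have hlaw {η : ℝ≥0∞} (hη : 0 < η) : ∃ δ : ℝ≥0∞, 0 < δ ∧ ∀ n A, MeasurableSet A →
      ν A < δ → (ℙ : Measure Ω) (ξ n ⁻¹' A) ≤ η := by
    obtain ⟨δ, hδ, hA⟩ := exists_forall_withDensity_le_of_tail_integral_lt ν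
      (q := fun n : Ici 1 => q n) (fun n => hqmeas n) (fun n => hqnonneg n) hint
      (fun ε hε => (h3 ε hε).imp fun K hK n => hK n n.2) hη
    have hpos (n : ℕ) (hn : 1 ≤ n) (A : Set ℝ) (hAm : MeasurableSet A) (hνA : ν A < δ) :
        (ℙ : Measure Ω) (ξ n ⁻¹' A) ≤ η := by
      rw [← Measure.map_apply (hξmeas n) hAm, hdens n hn]
      exact hA ⟨n, hn⟩ A hAm hνA
    refine ⟨δ, hδ, fun n A hAm hνA => ?_⟩
    rcases Nat.eq_zero_or_pos n with rfl | hn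
    · exact measure_preimage_le_of_tendstoInMeasure hξmeas (hξmeas 0) h1
        ((eventually_ge_atTop 1).mono hpos) hνA
    · exact hpos n hn A hAm hνA
  refine tendstoInMeasure_iff_dist.2 fun ε hε => ENNReal.tendsto_nhds_zero.2 fun η hη => ?_
  have hη4 : 0 < η / 4 := ENNReal.div_pos hη.ne' (by simp)
  have hε4 : 0 < ε / 4 := by positivity
  obtain ⟨δ, hδ, hA⟩ := hlaw hη4
  obtain ⟨δ', hδ', hδδ'⟩ := exists_between hδ
  obtain ⟨g, hg, hνg⟩ := exists_continuous_measure_le_dist_le ν (hfmeas 0) hε4 hδ'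
  have hgξ := h1.continuous_comp (fun n => (hξmeas n).aestronglyMeasurable) hg
  have hB : MeasurableSet {x | ε / 4 ≤ dist (f 0 x) (g x)} :=
    measurableSet_le measurable_const ((hfmeas 0).dist hg.measurable)
  filter_upwards [(tendstoInMeasure_iff_dist.1 h2 _ hε4).eventually_lt_const hδ,
    (tendstoInMeasure_iff_dist.1 hgξ _ hε4).eventually_le_const hη4] with n hfn hgn
  have hAn : MeasurableSet {x | ε / 4 ≤ dist (f n x) (f 0 x)} :=
    measurableSet_le measurable_const ((hfmeas n).dist (hfmeas 0))
  calc (ℙ : Measure Ω) {ω | ε ≤ dist (f n (ξ n ω)) (f 0 (ξ 0 ω))}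
      ≤ (ℙ : Measure Ω) (((ξ n ⁻¹' {x | ε / 4 ≤ dist (f n x) (f 0 x)} ∪
          ξ n ⁻¹' {x | ε / 4 ≤ dist (f 0 x) (g x)}) ∪
          {ω | ε / 4 ≤ dist (g (ξ n ω)) (g (ξ 0 ω))}) ∪
          ξ 0 ⁻¹' {x | ε / 4 ≤ dist (f 0 x) (g x)}) := by
        refine measure_mono fun ω hω => ?_
        by_contra! h
        simp only [mem_union, mem_preimage, mem_ofPred_eq, not_or, not_le] at h hω
        obtain ⟨⟨⟨ha, hb⟩, hc⟩, hd⟩ := h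
        rw [dist_comm (f 0 (ξ 0 ω))] at hd
        linarith [dist_triangle (f n (ξ n ω)) (f 0 (ξ n ω)) (f 0 (ξ 0 ω)),
          dist_triangle4 (f 0 (ξ n ω)) (g (ξ n ω)) (g (ξ 0 ω)) (f 0 (ξ 0 ω))]
    _ ≤ η / 4 + η / 4 + η / 4 + η / 4 := by
        refine (measure_union_le _ _).trans (add_le_add ?_ (hA 0 _ hB (hνg.trans_lt hδδ')))
        refine (measure_union_le _ _).trans (add_le_add ?_ hgn)
        exact (measure_union_le _ _).trans
          (add_le_add (hA n _ hAn hfn) (hA n _ hB (hνg.trans_lt hδδ')))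
    _ = η := by
        rw [← ENNReal.add_div, ← ENNReal.add_div, ← ENNReal.add_div,
          show η + η + η + η = η * 4 by ring]
        exact ENNReal.mul_div_cancel_right (by simp) (by simp)

end
end
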